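/- Let σ > -1 and λ = d+1+σ. For every norm |·| on ℂ^{d̃} satisfying |conj(Z)| = |Z| for all Z ∈ ℂ^{d̃}, the Bergman projection T_σ mapping L^∞(B) to the Bloch space satisfies ‖T_σ‖_{L^∞(B) → 𝓑} = sup_{‖G‖_∞ ≤ 1} ‖T_σ G‖_𝓑 = 𝓒 · Γ(λ+n)Γ(n) / Γ((λ+n)/2)², where 𝓒 = max_{ζ ∈ ℂ^d, |ζ|=1} |Z(ζ)|. -/

import Mathlib

open MeasureTheory Complex Metric
open scoped ENNReal Classical

noncomputable section

abbrev Cd (d : ℕ) : Type := EuclideanSpace ℂ (Fin d)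

instance (d : ℕ) : MeasurableSpace (Cd d) := borel _
instance (d : ℕ) : BorelSpace (Cd d) := ⟨rfl⟩
noncomputable instance (d : ℕ) : MeasureSpace (Cd d) := measureSpaceOfInnerProductSpace

/-- The open unit ball of `ℂ^d`. -/
def unitBall (d : ℕ) : Set (Cd d) := Metric.ball 0 1

/-- Lebesgue measure on `ℂ^d`, normalized so that the unit ball has measure one. -/
def normVol (d : ℕ) : Measure (Cd d) := (volume (unitBall d))⁻¹ • volume

/-- The inner product `⟨z,w⟩ = ∑ z_j conj (w_j)`. -/
def herm {d : ℕ} (z w : Cd d) : ℂ := ∑ j, z j * (starRingEnd ℂ) (w j)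

/-- The normalizing constant `c_σ`. -/
def cCoef (d : ℕ) (σ : ℝ) : ℝ :=
  Real.Gamma (d + σ + 1) / (Real.Gamma (σ + 1) * Real.Gamma (d + 1))

/-- The Bergman kernel `K_σ(z,w) = (1-|w|²)^σ / (1-⟨z,w⟩)^{d+1+σ}`. -/
def bergKer (d : ℕ) (σ : ℝ) (z w : Cd d) : ℂ :=
  (((1 - ‖w‖ ^ 2 : ℝ) ^ σ : ℝ) : ℂ) / (1 - herm z w) ^ ((((d : ℝ) + 1 + σ : ℝ)) : ℂ)

/-- The Bergman projection `T_σ f (z) = c_σ ∫_B K_σ(z,w) f(w) dv(w)`. -/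
def bergman (d : ℕ) (σ : ℝ) (f : Cd d → ℂ) (z : Cd d) : ℂ :=
  (cCoef d σ : ℂ) * ∫ w in unitBall d, bergKer d σ z w * f w ∂(normVol d)

/-- The complex partial derivative `∂/∂z_j`. -/
def pd (d : ℕ) (j : Fin d) (f : Cd d → ℂ) : Cd d → ℂ :=
  fun z => fderiv ℂ f z (EuclideanSpace.single j 1)

/-- The complex partial derivative `∂^α` for a multi-index `α`. -/
def mpd (d : ℕ) (α : Fin d → ℕ) (f : Cd d → ℂ) : Cd d → ℂ :=
  (List.finRange d).foldr (fun j g => (pd d j)^[α j] g) f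

/-- Multi-indices `α ∈ ℤ₊^d` with `|α| = n`; there are `d̃ = (n+d-1).choose (d-1)` of them. -/
def MIdx (d n : ℕ) : Type := {α : Fin d → ℕ // ∑ j, α j = n}

instance (d n : ℕ) : Fintype (MIdx d n) :=
  Fintype.subtype (Finset.Nat.antidiagonalTuple d n)
    (fun _ => Finset.Nat.mem_antidiagonalTuple)

/-- `𝒟_z f (z) = (∂^α f(z))_{|α|=n} ∈ ℂ^{d̃}`. -/
def Dmap (d n : ℕ) (f : Cd d → ℂ) (z : Cd d) : MIdx d n → ℂ := fun α => mpd d α.1 f z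

/-- `Z(ζ) = (ζ^α)_{|α|=n} ∈ ℂ^{d̃}`. -/
def Zmap (d n : ℕ) (ζ : Cd d) : MIdx d n → ℂ := fun α => ∏ j, ζ j ^ α.1 j

/-- The Bloch seminorm `‖f‖_𝓑 = sup_{z∈B} (1-|z|²)^n |𝒟_z f(z)|` w.r.t. a norm `N` on `ℂ^{d̃}`. -/
def blochSemi (d n : ℕ) (N : (MIdx d n → ℂ) → ℝ) (f : Cd d → ℂ) : ℝ :=
  ⨆ z : unitBall d, (1 - ‖(z : Cd d)‖ ^ 2) ^ n * N (Dmap d n f z)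

/-- The seminorm of `T_σ : L^∞(B) → 𝓑`, i.e. `sup_{‖G‖_∞ ≤ 1} ‖T_σ G‖_𝓑`. -/
def opSemi (d n : ℕ) (σ : ℝ) (N : (MIdx d n → ℂ) → ℝ) : ℝ :=
  ⨆ G : {G : Cd d → ℂ // Measurable G ∧ ∀ w, ‖G w‖ ≤ 1},
    blochSemi d n N (bergman d σ G.1)

/-- `𝓒 = max_{|ζ|=1} |Z(ζ)|`. -/
def maxC (d n : ℕ) (N : (MIdx d n → ℂ) → ℝ) : ℝ :=
  ⨆ ζ : Metric.sphere (0 : Cd d) 1, N (Zmap d n (ζ : Cd d))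

/-- The Möbius automorphism `φ_z` of the unit ball, with `φ_0 = -id`. -/
def moebius (d : ℕ) (z ω : Cd d) : Cd d :=
  if z = 0 then -ω
  else (1 - herm ω z)⁻¹ •
    (z - (herm ω z / ((‖z‖ ^ 2 : ℝ) : ℂ)) • z
       - ((Real.sqrt (1 - ‖z‖ ^ 2) : ℝ) : ℂ) • (ω - (herm ω z / ((‖z‖ ^ 2 : ℝ) : ℂ)) • z))

end

section
open Filter Topology

lemma gam_succ_mul (s : ℝ) (hs : 0 < s) (k : ℕ) :
    Real.Gamma (s + (k + 1 : ℕ)) = (s + k) * Real.Gamma (s + k) := by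
  push_cast
  rw [← add_assoc, Real.Gamma_add_one (by positivity)]

lemma choose_gam (s : ℝ) (hs : 0 < s) (k : ℕ) :
    Ring.choose (s + k - 1) k = Real.Gamma (s + k) / (Real.Gamma s * k.factorial) := by
  have h1 : Ring.choose (s + k - 1) k = Ring.multichoose s k := by
    rw [Ring.choose]; congr 1; ring
  rw [h1]
  have h2 := Ring.factorial_nsmul_multichoose_eq_ascPochhammer s k
  have hG : 0 < Real.Gamma s := Real.Gamma_pos_of_pos hs
  have h3 : ∀ k : ℕ, (ascPochhammer ℕ k).smeval s = Real.Gamma (s + k) / Real.Gamma s := by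
    intro k
    induction k with
    | zero => simp [hG.ne']
    | succ k ih =>
      rw [ascPochhammer_succ_right, Polynomial.smeval_mul, ih, gam_succ_mul s hs]
      simp [Polynomial.smeval_add, Polynomial.smeval_natCast]
      ring
  rw [h3, nsmul_eq_mul] at h2
  have : (k.factorial : ℝ) ≠ 0 := by positivity
  field_simp at h2 ⊢
  linarith

noncomputable def ac (s : ℝ) (k : ℕ) : ℝ := Real.Gamma (s + k) / (Real.Gamma s * k.factorial)

lemma ac_pos (s : ℝ) (hs : 0 < s) (k : ℕ) : 0 < ac s k := by
  have := Real.Gamma_pos_of_pos hs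
  have : 0 < Real.Gamma (s + k) := Real.Gamma_pos_of_pos (by positivity)
  unfold ac; positivity

lemma hasSum_ac (s : ℝ) (hs : 0 < s) (t : ℂ) (ht : ‖t‖ < 1) :
    HasSum (fun k => (ac s k : ℂ) * t ^ k) ((1 - t) ^ (-(s:ℂ))) := by
  have h := (Complex.one_div_one_sub_cpow_hasFPowerSeriesOnBall_zero (s:ℂ)).hasSum (y := t)
    (by simpa [enorm_eq_nnnorm, ← NNReal.coe_lt_coe] using ht)
  simp only [zero_add, FormalMultilinearSeries.ofScalars_apply_eq, one_div] at h
  rw [cpow_neg]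
  have e : (fun k => (ac s k : ℂ) * t ^ k) = fun n : ℕ => Ring.choose ((s:ℂ) + n - 1) n • t ^ n := by
    funext k
    have := choose_gam s hs k
    rw [ac, ← this, Complex.ofReal_choose, smul_eq_mul]
    simp
  rw [e]
  exact h

lemma hasSum_ac_real (s : ℝ) (hs : 0 < s) (t : ℝ) (ht0 : 0 ≤ t) (ht : t < 1) :
    HasSum (fun k => ac s k * t ^ k) ((1 - t) ^ (-s)) := by
  have h := hasSum_ac s hs t (by rwa [Complex.norm_real, Real.norm_of_nonneg ht0])
  have : ((1 - t : ℂ)) ^ (-(s:ℂ)) = (((1 - t) ^ (-s) : ℝ) : ℂ) := by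
    rw [Complex.ofReal_cpow (by linarith)]; simp
  rw [this] at h
  exact_mod_cast h

/-- the ratio -/
noncomputable def rk (s l m : ℝ) (k : ℕ) : ℝ :=
  Real.Gamma (s + k) ^ 2 / (Real.Gamma (l + k) * Real.Gamma (m + k))

lemma rk_le (s l m : ℝ) (hl : 0 < l) (hm : 0 < m) (h : 2 * s = l + m) (k : ℕ) : rk s l m k ≤ 1 := by
  have hl' : 0 < Real.Gamma (l + k) := Real.Gamma_pos_of_pos (by positivity)
  have hm' : 0 < Real.Gamma (m + k) := Real.Gamma_pos_of_pos (by positivity)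
  have hs' : 0 < Real.Gamma (s + k) := Real.Gamma_pos_of_pos (by
    have : 0 < s := by linarith
    positivity)
  unfold rk
  rw [div_le_one (by positivity)]
  have := Real.Gamma_mul_add_mul_le_rpow_Gamma_mul_rpow_Gamma (s := l + k) (t := m + k)
    (a := 1/2) (b := 1/2) (by positivity) (by positivity) (by norm_num) (by norm_num) (by norm_num)
  rw [show (1/2 : ℝ) * (l + k) + 1/2 * (m + k) = s + k by linarith, ← Real.mul_rpow hl'.le hm'.le,
    ← Real.sqrt_eq_rpow] at this
  calc _ ≤ (√(Real.Gamma (l + k) * Real.Gamma (m + k))) ^ 2 := by gcongr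
    _ = _ := Real.sq_sqrt (by positivity)

lemma prod_gam (s : ℝ) (hs : 0 < s) (k : ℕ) :
    ∏ j ∈ Finset.range k, (s + j) = Real.Gamma (s + k) / Real.Gamma s := by
  have hG : 0 < Real.Gamma s := Real.Gamma_pos_of_pos hs
  induction k with
  | zero => simp [hG.ne']
  | succ k ih => rw [Finset.prod_range_succ, ih, gam_succ_mul s hs]; ring

lemma rk_tendsto (s l m : ℝ) (hl : 0 < l) (hm : 0 < m) (h : 2 * s = l + m) :
    Tendsto (rk s l m) atTop (𝓝 1) := by
  have hs : 0 < s := by linarith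
  rw [← tendsto_add_atTop_iff_nat 1]
  have key : ∀ s : ℝ, 0 < s → Tendsto (fun k : ℕ => Real.GammaSeq s k / Real.Gamma s) atTop (𝓝 1) := by
    intro s hs
    have := (Real.GammaSeq_tendsto_Gamma s).div_const (Real.Gamma s)
    rwa [div_self (Real.Gamma_pos_of_pos hs).ne'] at this
  have := ((key l hl).mul (key m hm)).div ((key s hs).pow 2) (by norm_num)
  simp only [mul_one, one_pow, div_one] at this
  refine this.congr' ?_
  filter_upwards [eventually_gt_atTop 0] with k hk
  have hk' : (0:ℝ) < k := by exact_mod_cast hk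
  simp only [Real.GammaSeq, prod_gam _ hl, prod_gam _ hm, prod_gam _ hs, rk, Pi.div_apply]
  have e : (k:ℝ) ^ l * (k:ℝ) ^ m = ((k:ℝ) ^ s) ^ 2 := by
    rw [← Real.rpow_add hk', ← h, ← Real.rpow_natCast, ← Real.rpow_mul hk'.le]
    congr 1; push_cast; ring
  have hl' : 0 < Real.Gamma (l + (k+1:ℕ)) := Real.Gamma_pos_of_pos (by positivity)
  have hm' : 0 < Real.Gamma (m + (k+1:ℕ)) := Real.Gamma_pos_of_pos (by positivity)
  have hs' : 0 < Real.Gamma (s + (k+1:ℕ)) := Real.Gamma_pos_of_pos (by positivity)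
  have hl2 : 0 < Real.Gamma l := Real.Gamma_pos_of_pos (by positivity)
  have hm2 : 0 < Real.Gamma m := Real.Gamma_pos_of_pos (by positivity)
  have hs2 : 0 < Real.Gamma s := Real.Gamma_pos_of_pos (by positivity)
  have : (k.factorial : ℝ) ≠ 0 := by positivity
  have hks : (0:ℝ) < (k:ℝ) ^ s := by positivity
  field_simp
  exact e

/-- coefficients of the Forelli-Rudin series -/
noncomputable def fc (s l : ℝ) (k : ℕ) : ℝ :=
  ac s k ^ 2 * (k.factorial * Real.Gamma l / Real.Gamma (l + k))

noncomputable def MM (s l m : ℝ) : ℝ := Real.Gamma l * Real.Gamma m / Real.Gamma s ^ 2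

lemma fc_eq (s l m : ℝ) (hl : 0 < l) (hm : 0 < m) (h : 2 * s = l + m) (k : ℕ) :
    fc s l k = MM s l m * (rk s l m k * ac m k) := by
  have hs : 0 < s := by linarith
  have hl' : 0 < Real.Gamma (l + k) := Real.Gamma_pos_of_pos (by positivity)
  have hm' : 0 < Real.Gamma (m + k) := Real.Gamma_pos_of_pos (by positivity)
  have hs' : 0 < Real.Gamma (s + k) := Real.Gamma_pos_of_pos (by positivity)
  have hl2 : 0 < Real.Gamma l := Real.Gamma_pos_of_pos (by positivity)
  have hm2 : 0 < Real.Gamma m := Real.Gamma_pos_of_pos (by positivity)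
  have hs2 : 0 < Real.Gamma s := Real.Gamma_pos_of_pos (by positivity)
  have : (k.factorial : ℝ) ≠ 0 := by positivity
  unfold fc MM rk ac
  field_simp

lemma MM_pos (s l m : ℝ) (hl : 0 < l) (hm : 0 < m) (h : 2 * s = l + m) : 0 < MM s l m := by
  have hl2 : 0 < Real.Gamma l := Real.Gamma_pos_of_pos (by positivity)
  have hm2 : 0 < Real.Gamma m := Real.Gamma_pos_of_pos (by positivity)
  have hs2 : 0 < Real.Gamma s := Real.Gamma_pos_of_pos (by linarith)
  unfold MM; positivity

lemma rk_pos (s l m : ℝ) (hl : 0 < l) (hm : 0 < m) (h : 2 * s = l + m) (k : ℕ) : 0 < rk s l m k := by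
  have hs : 0 < s := by linarith
  have hl' : 0 < Real.Gamma (l + k) := Real.Gamma_pos_of_pos (by positivity)
  have hm' : 0 < Real.Gamma (m + k) := Real.Gamma_pos_of_pos (by positivity)
  have hs' : 0 < Real.Gamma (s + k) := Real.Gamma_pos_of_pos (by positivity)
  unfold rk; positivity

lemma fr_upper (s l m : ℝ) (hl : 0 < l) (hm : 0 < m) (h : 2 * s = l + m) (x S : ℝ) (hx0 : 0 ≤ x)
    (hx : x < 1) (hS : HasSum (fun k => fc s l k * x ^ k) S) :
    (1 - x) ^ m * S ≤ MM s l m := by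
  have h1 := (hasSum_ac_real m hm x hx0 hx).mul_left (MM s l m)
  have hM := MM_pos s l m hl hm h
  have h2 : S ≤ MM s l m * (1 - x) ^ (-m) := by
    refine hasSum_le (fun k => ?_) hS h1
    rw [fc_eq s l m hl hm h, mul_assoc, mul_assoc]
    have := ac_pos m hm k
    have := rk_le s l m hl hm h k
    have : rk s l m k * (ac m k * x ^ k) ≤ 1 * (ac m k * x ^ k) := by gcongr
    rw [one_mul] at this
    gcongr
  have h3 : 0 < 1 - x := by linarith
  calc _ ≤ (1 - x) ^ m * (MM s l m * (1 - x) ^ (-m)) := by gcongr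
    _ = _ := by rw [Real.rpow_neg h3.le]; field_simp

lemma fr_lower (s l m : ℝ) (hl : 0 < l) (hm : 0 < m) (h : 2 * s = l + m) (S : ℝ → ℝ)
    (hS : ∀ x, 0 ≤ x → x < 1 → HasSum (fun k => fc s l k * x ^ k) (S x)) :
    Tendsto (fun x => (1 - x) ^ m * S x) (𝓝[<] 1) (𝓝 (MM s l m)) := by
  have hM := MM_pos s l m hl hm h
  have hev : ∀ᶠ x : ℝ in 𝓝[<] 1, 0 ≤ x ∧ x < 1 := by
    filter_upwards [Ico_mem_nhdsLT (show (0:ℝ) < 1 by norm_num)] with x hx using hx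
  refine tendsto_order.2 ⟨fun a ha => ?_, fun a ha => ?_⟩
  swap
  · filter_upwards [hev] with x hx
    exact (fr_upper s l m hl hm h x _ hx.1 hx.2 (hS x hx.1 hx.2)).trans_lt ha
  obtain ⟨ε, hε, hε1⟩ : ∃ ε > 0, a < MM s l m * (1 - ε) := by
    refine ⟨(1 - a / MM s l m) / 2, ?_, ?_⟩
    · have : a / MM s l m < 1 := by rwa [div_lt_one hM]
      linarith
    · field_simp; nlinarith
  obtain ⟨K, hK⟩ := eventually_atTop.1 ((rk_tendsto s l m hl hm h).eventually
    (lt_mem_nhds (show 1 - ε < 1 by linarith)))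
  have hlim : Tendsto (fun x : ℝ => MM s l m * (1 - ε) - (1 - x) ^ m * (|MM s l m * (1-ε)| * ∑ k ∈ Finset.range K, ac m k))
      (𝓝[<] 1) (𝓝 (MM s l m * (1 - ε))) := by
    have : ContinuousAt (fun x : ℝ => MM s l m * (1 - ε) - (1 - x) ^ m * (|MM s l m * (1-ε)| * ∑ k ∈ Finset.range K, ac m k)) 1 := by
      refine continuousAt_const.sub (ContinuousAt.mul ?_ continuousAt_const)
      exact ContinuousAt.rpow_const (by fun_prop) (Or.inr hm.le)
    have := this.tendsto.mono_left (nhdsWithin_le_nhds (s := Set.Iio 1))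
    simpa [Real.zero_rpow hm.ne'] using this
  filter_upwards [hev, hlim.eventually (lt_mem_nhds hε1)] with x hx hx2
  refine hx2.trans_le ?_
  have h3 : 0 < 1 - x := by linarith [hx.2]
  have h1 := (hasSum_ac_real m hm x hx.1 hx.2).mul_left (MM s l m * (1 - ε))
  have h4 : HasSum (fun k => if k ∈ Finset.range K then |MM s l m * (1-ε)| * ac m k else 0)
      (∑ k ∈ Finset.range K, |MM s l m * (1-ε)| * ac m k) := by
    have := hasSum_sum_of_ne_finset_zero (f := fun k => if k ∈ Finset.range K then |MM s l m * (1-ε)| * ac m k else 0) (s := Finset.range K) (L := .unconditional ℕ)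
      (by intro b hb; simp [hb])
    convert this using 1
    exact Finset.sum_congr rfl (fun k hk => by simp only [hk, if_true])
  have h5 := h1.sub h4
  have h2 : MM s l m * (1-ε) * (1 - x) ^ (-m) - ∑ k ∈ Finset.range K, |MM s l m * (1-ε)| * ac m k ≤ S x := by
    refine hasSum_le (fun k => ?_) h5 (hS x hx.1 hx.2)
    rw [fc_eq s l m hl hm h]
    have p1 := ac_pos m hm k
    have p2 := rk_pos s l m hl hm h k
    have p3 : 0 ≤ x ^ k := pow_nonneg hx.1 _
    have p4 : x ^ k ≤ 1 := pow_le_one₀ hx.1 hx.2.le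
    split_ifs with hk
    · have : MM s l m * (1-ε) * (ac m k * x ^ k) ≤ |MM s l m * (1-ε)| * ac m k := by
        calc _ ≤ |MM s l m * (1-ε)| * (ac m k * x ^ k) := by gcongr; exact le_abs_self _
          _ ≤ |MM s l m * (1-ε)| * (ac m k * 1) := by gcongr
          _ = _ := by ring
      have : 0 ≤ MM s l m * (rk s l m k * ac m k) * x ^ k := by positivity
      linarith
    · have := hK k (by simpa using hk)
      rw [sub_zero]
      calc _ = MM s l m * ((1 - ε) * ac m k) * x ^ k := by ring
        _ ≤ _ := by gcongr
  calc _ = (1 - x) ^ m * (MM s l m * (1-ε) * (1 - x) ^ (-m) - ∑ k ∈ Finset.range K, |MM s l m * (1-ε)| * ac m k) := by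
        rw [Real.rpow_neg h3.le, ← Finset.mul_sum]; field_simp
    _ ≤ _ := by gcongr


lemma polar {E : Type*} [NormedAddCommGroup E] [NormedSpace ℝ E] [FiniteDimensional ℝ E]
    [MeasurableSpace E] [BorelSpace E] [Nontrivial E] (μ : Measure E) [μ.IsAddHaarMeasure]
    (h : E → ℝ) (f : ℝ → ℝ) (m : ℕ) (hh : ∀ r : ℝ, 0 < r → ∀ u, h (r • u) = r ^ m * h u) :
    ∫ x, h x * f ‖x‖ ∂μ = (∫ u : sphere (0:E) 1, h u ∂μ.toSphere) *
      ∫ r in Set.Ioi (0:ℝ), r ^ (Module.finrank ℝ E - 1) * (r ^ m * f r) :=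
  calc
    ∫ x, h x * f ‖x‖ ∂μ = ∫ x : ({(0)}ᶜ : Set E), h x.1 * f (‖x.1‖) ∂(μ.comap (↑)) := by
      rw [integral_subtype_comap (measurableSet_singleton _).compl fun x ↦ h x * f (‖x‖),
        restrict_compl_singleton]
    _ = ∫ x, h x.1 * (x.2.1 ^ m * f x.2.1) ∂μ.toSphere.prod (.volumeIoiPow (Module.finrank ℝ E - 1)) := by
      rw [← μ.measurePreserving_homeomorphUnitSphereProd.integral_comp
        (Homeomorph.measurableEmbedding _)]
      refine integral_congr_ae (ae_of_all _ fun x => ?_)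
      have hx : 0 < ‖x.1‖ := norm_pos_iff.2 x.2
      have := hh ‖x.1‖ hx (‖x.1‖⁻¹ • x.1)
      rw [smul_smul, mul_inv_cancel₀ hx.ne', one_smul] at this
      simp [this]
      ring
    _ = (∫ u : sphere (0:E) 1, h u ∂μ.toSphere) * ∫ x : Set.Ioi (0 : ℝ), x.1 ^ m * f x.1 ∂.volumeIoiPow (Module.finrank ℝ E - 1) :=
      integral_prod_mul (fun u : sphere (0:E) 1 => h u) (fun x : Set.Ioi (0 : ℝ) => x.1 ^ m * f x.1)
    _ = _ := by
      congr 1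
      simp only [Measure.volumeIoiPow, ENNReal.ofReal]
      rw [integral_withDensity_eq_integral_smul, 
        integral_subtype_comap measurableSet_Ioi fun a ↦ Real.toNNReal (a ^ (Module.finrank ℝ E - 1)) • (a ^ m * f a),
        setIntegral_congr_fun measurableSet_Ioi fun x hx ↦ ?_]
      · rw [NNReal.smul_def, Real.coe_toNNReal _ (pow_nonneg hx.out.le _), smul_eq_mul]
      · exact (measurable_subtype_coe.pow_const _).real_toNNReal

lemma beta_real (a b : ℝ) (ha : 0 < a) (hb : 0 < b) :
    ∫ t in Set.Ioi (0:ℝ), t ^ (a - 1) * (if t < 1 then (1 - t) ^ (b - 1) else 0) =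
      Real.Gamma a * Real.Gamma b / Real.Gamma (a + b) := by
  have h1 := Complex.betaIntegral_eq_Gamma_mul_div a b (by simpa) (by simpa)
  rw [betaIntegral, intervalIntegral.integral_of_le (by norm_num), integral_Ioc_eq_integral_Ioo] at h1
  have h2 : ∫ t in Set.Ioo (0:ℝ) 1, (t:ℂ) ^ ((a:ℂ) - 1) * (1 - (t:ℂ)) ^ ((b:ℂ) - 1) =
     ((∫ t in Set.Ioo (0:ℝ) 1, t ^ (a - 1) * (1 - t) ^ (b - 1) : ℝ) : ℂ) := by
    rw [← integral_complex_ofReal]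
    refine setIntegral_congr_fun measurableSet_Ioo fun t ht => ?_
    rw [Complex.ofReal_mul, Complex.ofReal_cpow ht.1.le, Complex.ofReal_cpow (by linarith [ht.2])]
    simp
  rw [h2, ← Complex.ofReal_add, Complex.Gamma_ofReal, Complex.Gamma_ofReal, Complex.Gamma_ofReal] at h1
  have h3 : ∫ t in Set.Ioo (0:ℝ) 1, t ^ (a - 1) * (1 - t) ^ (b - 1) = Real.Gamma a * Real.Gamma b / Real.Gamma (a + b) := by
    exact_mod_cast h1
  rw [← h3, ← integral_indicator measurableSet_Ioi, ← integral_indicator measurableSet_Ioo]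
  congr 1
  funext t
  by_cases h0 : 0 < t <;> by_cases h1 : t < 1 <;> simp [Set.indicator, h0, h1]

lemma radial_beta (d k : ℕ) (hd : 0 < d) (σ : ℝ) (hσ : -1 < σ) :
    ∫ r in Set.Ioi (0:ℝ), r ^ (2 * d - 1) * (r ^ (2 * k) * (if r < 1 then (1 - r ^ 2) ^ σ else 0)) =
      1 / 2 * (Real.Gamma (d + k) * Real.Gamma (σ + 1) / Real.Gamma (d + k + (σ + 1))) := by
  have hd' : (0:ℝ) < d + k := by positivity
  rw [← beta_real _ _ hd' (by linarith), ← integral_comp_rpow_Ioi_of_pos (p := 2) (by norm_num)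
      (g := fun t => t ^ ((d:ℝ) + k - 1) * (if t < 1 then (1 - t) ^ (σ + 1 - 1) else 0)),
    ← integral_const_mul]
  refine setIntegral_congr_fun measurableSet_Ioi fun r hr => ?_
  have hr : 0 < r := hr
  have e1 : r ^ (2:ℝ) < 1 ↔ r < 1 := by
    rw [Real.rpow_two]; exact sq_lt_one_iff₀ hr.le
  have e2 : r ^ (2 * d - 1) * r ^ (2 * k) = r * (r ^ (2:ℝ)) ^ ((d:ℝ) + k - 1) := by
    rw [← Real.rpow_mul hr.le, ← Real.rpow_one_add' hr.le, ← pow_add, ← Real.rpow_natCast]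
    · congr 1
      have : 1 ≤ 2 * d := by omega
      push_cast [this]; ring
    · have : (1:ℝ) ≤ d := by exact_mod_cast hd
      have : (0:ℝ) ≤ k := by positivity
      nlinarith
  simp only [smul_eq_mul, e1]
  rw [← mul_assoc, e2]
  norm_num
  split_ifs
  · ring
  · ring

lemma radial_gauss (d k : ℕ) (hd : 0 < d) :
    ∫ r in Set.Ioi (0:ℝ), r ^ (2 * d - 1) * (r ^ (2 * k) * Real.exp (-r ^ 2)) =
      1 / 2 * Real.Gamma (d + k) := by
  have := _root_.integral_rpow_mul_exp_neg_rpow (p := 2) (q := 2 * d + 2 * k - 1) (by norm_num) (by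
    have : (1:ℝ) ≤ d := by exact_mod_cast hd
    have : (0:ℝ) ≤ k := by positivity
    linarith)
  rw [show ((2 * d + 2 * k - 1 : ℝ) + 1) / 2 = d + k by ring] at this
  rw [← this]
  refine setIntegral_congr_fun measurableSet_Ioi fun r hr => ?_
  have hr : 0 < r := hr
  rw [← mul_assoc, ← pow_add, Real.rpow_two, ← Real.rpow_natCast]
  congr 2
  have : 1 ≤ 2 * d := by omega
  push_cast [this]; ring

lemma Cd_finrank (d : ℕ) : Module.finrank ℝ (Cd d) = 2 * d := by
  rw [← Module.finrank_mul_finrank ℝ ℂ (Cd d)]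
  simp

lemma Cd_mp (d : ℕ) (U : Cd d ≃ₗᵢ[ℂ] Cd d) :
    MeasurePreserving U (volume : Measure (Cd d)) volume :=
  LinearIsometryEquiv.measurePreserving
    ({ U with map_smul' := fun r x => by simp } : Cd d ≃ₗᵢ[ℝ] Cd d)

lemma gauss_pi (d k : ℕ) (i₀ : Fin d) :
    ∫ w : Fin d → ℂ, ‖w i₀‖ ^ (2 * k) * Real.exp (-∑ i, ‖w i‖ ^ 2) = Real.pi ^ d * k.factorial := by
  have key : ∀ k : ℕ, ∫ x : ℂ, ‖x‖ ^ (2 * k) * Real.exp (-‖x‖ ^ 2) = Real.pi * k.factorial := by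
    intro k
    have := Complex.integral_rpow_mul_exp_neg_rpow (p := 2) (q := 2 * k) (by norm_num) (by
      have : (0:ℝ) ≤ k := by positivity
      linarith)
    rw [show (2 * (k:ℝ) + 2) / 2 = k + 1 by ring, Real.Gamma_nat_eq_factorial] at this
    rw [show 2 * Real.pi / 2 = Real.pi by ring] at this
    rw [← this]
    congr 1
    funext x
    rw [Real.rpow_two, ← Real.rpow_natCast]
    push_cast; rfl
  have e : ∀ w : Fin d → ℂ, ‖w i₀‖ ^ (2 * k) * Real.exp (-∑ i, ‖w i‖ ^ 2) =
      ∏ i, (‖w i‖ ^ (2 * (if i = i₀ then k else 0)) * Real.exp (-‖w i‖ ^ 2)) := by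
    intro w
    rw [Finset.prod_mul_distrib, ← Real.exp_sum, Finset.sum_neg_distrib]
    congr 1
    rw [Finset.prod_eq_single i₀]
    · simp
    · intro b _ hb; simp [hb]
    · simp
  simp_rw [e]
  rw [integral_fintype_prod_volume_eq_prod (fun i x => ‖x‖ ^ (2 * (if i = i₀ then k else 0)) * Real.exp (-‖x‖ ^ 2))]
  simp_rw [key]
  rw [Finset.prod_mul_distrib, Finset.prod_eq_single i₀ (f := fun x => (((if x = i₀ then k else 0).factorial : ℕ) : ℝ))]
  · simp
  · intro b _ hb; simp [hb]
  · simp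

lemma gauss_Cd (d : ℕ) : ∃ c : ℝ, 0 < c ∧ ∀ (k : ℕ) (i₀ : Fin d),
    ∫ w : Cd d, ‖w i₀‖ ^ (2 * k) * Real.exp (-‖w‖ ^ 2) = c * k.factorial := by
  let e : (Fin d → ℂ) ≃L[ℝ] Cd d := (PiLp.continuousLinearEquiv 2 ℝ (fun _ : Fin d => ℂ)).symm
  let μ : Measure (Cd d) := Measure.map e volume
  have : μ.IsAddHaarMeasure := e.isAddHaarMeasure_map volume
  obtain ⟨c0, hc0, hμ⟩ : ∃ c0 : NNReal, 0 < c0 ∧ (volume : Measure (Cd d)) = c0 • μ :=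
    ⟨_, Measure.addHaarScalarFactor_pos_of_isAddHaarMeasure _ _,
      Measure.isAddLeftInvariant_eq_smul (volume : Measure (Cd d)) μ⟩
  refine ⟨c0 * Real.pi ^ d, by positivity, fun k i₀ => ?_⟩
  · rw [hμ, integral_smul_nnreal_measure, NNReal.smul_def, smul_eq_mul, mul_assoc]
    congr 1
    rw [← gauss_pi d k i₀]
    have := e.toHomeomorph.measurableEmbedding.integral_map (μ := volume) (fun w : Cd d => ‖w i₀‖ ^ (2 * k) * Real.exp (-‖w‖ ^ 2))
    refine this.trans ?_
    congr 1
    funext w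
    have h1 : ‖e w‖ ^ 2 = ∑ i, ‖w i‖ ^ 2 := by
      rw [EuclideanSpace.norm_sq_eq]; rfl
    change ‖w i₀‖ ^ (2 * k) * Real.exp (-‖e w‖ ^ 2) = _
    rw [h1]


lemma herm_eq (d : ℕ) (z w : Cd d) : herm z w = inner ℂ w z := by
  simp [herm, PiLp.inner_apply, RCLike.inner_apply]

lemma exists_iso (d : ℕ) (i₀ : Fin d) (z : Cd d) :
    ∃ U : Cd d ≃ₗᵢ[ℂ] Cd d, ∀ w, ‖herm z w‖ = ‖z‖ * ‖(U w) i₀‖ := by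
  by_cases hz : z = 0
  · exact ⟨LinearIsometryEquiv.refl ℂ _, fun w => by simp [hz, herm]⟩
  have hz' : ‖z‖ ≠ 0 := norm_ne_zero_iff.2 hz
  obtain ⟨b, hb⟩ := Orthonormal.exists_orthonormalBasis_extension_of_card_eq (𝕜 := ℂ) (E := Cd d)
    (ι := Fin d) (by simp) (v := fun _ => ((‖z‖ : ℂ)⁻¹) • z) (s := {i₀}) (by
      rw [orthonormal_iff_ite]
      rintro ⟨i, hi⟩ ⟨j, hj⟩
      have hi : i = i₀ := hi
      have hj : j = i₀ := hj
      subst hi; subst hj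
      have : ‖((‖z‖ : ℂ)⁻¹) • z‖ = 1 := by
        rw [norm_smul]; simp [hz']
      simp [Set.domRestrict, inner_self_eq_norm_sq_to_K, this])
  refine ⟨b.repr, fun w => ?_⟩
  rw [OrthonormalBasis.repr_apply_apply, hb i₀ rfl, inner_smul_left, norm_mul, herm_eq,
    norm_inner_symm]
  simp
  field_simp

lemma iso_int (d k : ℕ) (i₀ : Fin d) (z : Cd d) (g : ℝ → ℝ) :
    ∫ w : Cd d, ‖herm z w‖ ^ (2 * k) * g ‖w‖ = ‖z‖ ^ (2 * k) * ∫ w : Cd d, ‖w i₀‖ ^ (2 * k) * g ‖w‖ := by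
  obtain ⟨U, hU⟩ := exists_iso d i₀ z
  rw [← (Cd_mp d U).integral_comp U.toHomeomorph.measurableEmbedding
    (fun w : Cd d => ‖w i₀‖ ^ (2 * k) * g ‖w‖), ← integral_const_mul]
  congr 1
  funext w
  rw [hU, mul_pow, U.norm_map, mul_assoc]

noncomputable def gs (σ r : ℝ) : ℝ := if r < 1 then (1 - r ^ 2) ^ σ else 0

lemma moment_aux (d : ℕ) (hd : 0 < d) : ∃ c : ℝ, 0 < c ∧ ∀ (k : ℕ) (σ : ℝ) (_ : -1 < σ) (z : Cd d),
    ∫ w : Cd d, ‖herm z w‖ ^ (2 * k) * gs σ ‖w‖ =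
      c * (k.factorial * Real.Gamma (σ + 1) / Real.Gamma (d + k + (σ + 1))) * ‖z‖ ^ (2 * k) := by
  obtain ⟨c, hc, H⟩ := gauss_Cd d
  have : Nonempty (Fin d) := ⟨⟨0, hd⟩⟩
  refine ⟨c, hc, fun k σ hσ z => ?_⟩
  let i₀ : Fin d := ⟨0, hd⟩
  rw [iso_int d k i₀ z, mul_comm]
  congr 1
  have h1 := H k i₀
  have hh : ∀ r : ℝ, 0 < r → ∀ u : Cd d, (fun w : Cd d => ‖w i₀‖ ^ (2 * k)) (r • u) = r ^ (2 * k) * (fun w : Cd d => ‖w i₀‖ ^ (2 * k)) u := by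
    intro r hr u
    simp [mul_pow, abs_of_pos hr]
  rw [polar volume (fun w : Cd d => ‖w i₀‖ ^ (2 * k)) (fun r => Real.exp (-r ^ 2)) (2 * k) hh, Cd_finrank,
    radial_gauss d k hd] at h1
  rw [polar volume (fun w : Cd d => ‖w i₀‖ ^ (2 * k)) (gs σ) (2 * k) hh, Cd_finrank]
  unfold gs
  rw [radial_beta d k hd σ hσ]
  have hG : 0 < Real.Gamma (d + k) := Real.Gamma_pos_of_pos (by positivity)
  have e : c * (k.factorial * Real.Gamma (σ + 1) / Real.Gamma (d + k + (σ + 1))) = 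
    (c * k.factorial) * (Real.Gamma (σ + 1) / Real.Gamma (d + k + (σ + 1))) := by ring
  rw [e, ← h1]
  ring

lemma gs_int (d : ℕ) (σ : ℝ) {F : Type*} [NormedAddCommGroup F] [NormedSpace ℝ F] (f : Cd d → F) :
    ∫ w, (gs σ ‖w‖) • f w ∂(normVol d) = ∫ w in unitBall d, ((1 - ‖w‖ ^ 2) ^ σ : ℝ) • f w ∂(normVol d) := by
  rw [← integral_indicator (by unfold unitBall; exact measurableSet_ball)]
  congr 1
  funext w
  by_cases h : ‖w‖ < 1 <;> simp [unitBall, Set.indicator, gs, h]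

lemma vol_real (d : ℕ) (c : ℝ)
   (H : ∀ (k : ℕ) (σ : ℝ) (_ : -1 < σ) (z : Cd d),
    ∫ w : Cd d, ‖herm z w‖ ^ (2 * k) * gs σ ‖w‖ =
      c * (k.factorial * Real.Gamma (σ + 1) / Real.Gamma (d + k + (σ + 1))) * ‖z‖ ^ (2 * k)) :
   (volume : Measure (Cd d)).real (unitBall d) = c / Real.Gamma (d + 1) := by
  have h := H 0 0 (by norm_num) 0
  simp only [mul_zero, pow_zero, one_mul, Nat.factorial_zero, zero_add, Real.Gamma_one, mul_one, Nat.cast_zero, add_zero] at h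
  have : ∀ w : Cd d, gs 0 ‖w‖ = (unitBall d).indicator 1 w := by
    intro w
    by_cases h : ‖w‖ < 1 <;> simp [unitBall, Set.indicator, gs, h]
  simp_rw [this] at h
  rw [integral_indicator_one (by unfold unitBall; exact measurableSet_ball)] at h
  rw [h]
  simp [div_eq_mul_inv]

lemma moment (d k : ℕ) (hd : 0 < d) (σ : ℝ) (hσ : -1 < σ) (z : Cd d) :
    cCoef d σ * ∫ w in unitBall d, (1 - ‖w‖ ^ 2) ^ σ * ‖herm z w‖ ^ (2 * k) ∂(normVol d) =
      k.factorial * Real.Gamma (d + 1 + σ) / Real.Gamma (d + 1 + σ + k) * ‖z‖ ^ (2 * k) := by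
  obtain ⟨c, hc, H⟩ := moment_aux d hd
  have hv := vol_real d c H
  have := gs_int d σ (fun w => ‖herm z w‖ ^ (2 * k))
  simp only [smul_eq_mul] at this
  rw [← this, normVol, integral_smul_measure, ENNReal.toReal_inv]
  change cCoef d σ * ((volume.real (unitBall d))⁻¹ • _) = _
  rw [hv]
  simp_rw [mul_comm (gs σ _)]
  rw [H k σ hσ z, cCoef, smul_eq_mul]
  have h1 : 0 < Real.Gamma (σ + 1) := Real.Gamma_pos_of_pos (by linarith)
  have h2 : 0 < Real.Gamma ((d:ℝ) + 1) := Real.Gamma_pos_of_pos (by positivity)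
  rw [show (d:ℝ) + k + (σ + 1) = d + 1 + σ + k by ring, show (d:ℝ) + σ + 1 = d + 1 + σ by ring]
  have h3 : 0 < Real.Gamma ((d:ℝ) + 1 + σ + k) := Real.Gamma_pos_of_pos (by
    have : 0 < 1 + σ := by linarith
    have : (0:ℝ) ≤ d + k := by positivity
    linarith)
  field_simp

lemma rho_integrable (d : ℕ) (hd : 0 < d) (σ : ℝ) (hσ : -1 < σ) :
    IntegrableOn (fun w : Cd d => (1 - ‖w‖ ^ 2) ^ σ) (unitBall d) (normVol d) := by
  by_contra h
  have h1 := moment d 0 hd σ hσ 0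
  simp only [mul_zero, pow_zero, mul_one, Nat.cast_zero, add_zero] at h1
  rw [integral_undef h] at h1
  have h3 : 0 < Real.Gamma ((d:ℝ) + 1 + σ) := Real.Gamma_pos_of_pos (by
    have : 0 < 1 + σ := by linarith
    have : (0:ℝ) ≤ d := by positivity
    linarith)
  simp [h3.ne'] at h1


lemma herm_smul_right (d : ℕ) (z w : Cd d) (u : ℂ) :
    herm z (u • w) = (starRingEnd ℂ) u * herm z w := by
  rw [herm_eq, herm_eq, inner_smul_left]

lemma norm_herm_le (d : ℕ) (z w : Cd d) : ‖herm z w‖ ≤ ‖z‖ * ‖w‖ := by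
  rw [herm_eq, mul_comm]; exact norm_inner_le_norm _ _

lemma herm_cont (d : ℕ) (z : Cd d) : Continuous (fun w : Cd d => herm z w) := by
  simp_rw [herm_eq]; fun_prop

lemma mem_uB {d : ℕ} {w : Cd d} : w ∈ unitBall d ↔ ‖w‖ < 1 := by simp [unitBall]

lemma uB_meas (d : ℕ) : MeasurableSet (unitBall d) := by
  unfold unitBall; exact measurableSet_ball

lemma offdiag (d : ℕ) (σ : ℝ) (z : Cd d) (j k : ℕ) (hjk : j ≠ k) :
    ∫ w in unitBall d, ((1 - ‖w‖ ^ 2) ^ σ : ℝ) • (herm z w ^ j * (starRingEnd ℂ) (herm z w) ^ k)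
      ∂(normVol d) = 0 := by
  rw [← gs_int, normVol, integral_smul_measure]
  suffices h : ∫ w : Cd d, (gs σ ‖w‖) • (herm z w ^ j * (starRingEnd ℂ) (herm z w) ^ k) = 0 by
    rw [h, smul_zero]
  have hne : ((k:ℂ) - j) ≠ 0 := by
    rw [sub_ne_zero]; exact_mod_cast hjk.symm
  let θ : ℝ := Real.pi / ((k:ℝ) - j)
  let u : ℂ := Complex.exp (θ * I)
  have hu : ‖u‖ = 1 := Complex.norm_exp_ofReal_mul_I _
  have hu0 : u ≠ 0 := Complex.exp_ne_zero _
  have hconj : (starRingEnd ℂ) u = Complex.exp (-(θ * I)) := by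
    simp only [u]; rw [← Complex.exp_conj]; simp
  have hkey : (starRingEnd ℂ) u ^ j * u ^ k = -1 := by
    rw [hconj, ← Complex.exp_nat_mul, ← Complex.exp_nat_mul, ← Complex.exp_add, ← Complex.exp_pi_mul_I]
    congr 1
    simp only [θ]; push_cast
    field_simp
    ring
  let U : Cd d ≃ₗᵢ[ℂ] Cd d :=
    { LinearEquiv.smulOfNeZero ℂ (Cd d) u hu0 with
      norm_map' := fun x => by
        change ‖u • x‖ = ‖x‖
        rw [norm_smul, hu, one_mul] }
  have hU : ∀ w, U w = u • w := fun w => rfl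
  have h := (Cd_mp d U).integral_comp U.toHomeomorph.measurableEmbedding
    (fun w : Cd d => (gs σ ‖w‖) • (herm z w ^ j * (starRingEnd ℂ) (herm z w) ^ k))
  have h2 : ∀ w : Cd d, (fun w : Cd d => (gs σ ‖w‖) • (herm z w ^ j * (starRingEnd ℂ) (herm z w) ^ k)) (U w)
      = -((gs σ ‖w‖) • (herm z w ^ j * (starRingEnd ℂ) (herm z w) ^ k)) := by
    intro w
    simp only [hU, norm_smul, hu, one_mul, herm_smul_right, map_mul, Complex.conj_conj, mul_pow]
    rw [← smul_neg]
    congr 1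
    linear_combination (herm z w ^ j * (starRingEnd ℂ) (herm z w) ^ k) * hkey
  simp_rw [h2] at h
  rw [integral_neg] at h
  exact CharZero.eq_neg_self_iff.1 h.symm

lemma one_sub_re_pos {t : ℂ} (ht : ‖t‖ < 1) : 0 < (1 - t).re := by
  have := Complex.re_le_norm t
  simp; linarith

lemma ker_norm (s : ℝ) (t : ℂ) (ht : ‖t‖ < 1) :
    (1 - t) ^ (-(s:ℂ)) * (starRingEnd ℂ) ((1 - t) ^ (-(s:ℂ))) = ((‖1 - t‖ ^ (-(2 * s)) : ℝ) : ℂ) := by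
  have h0 : 1 - t ≠ 0 := fun h => by have := one_sub_re_pos ht; simp [h] at this
  have hp : 0 < ‖1 - t‖ := norm_pos_iff.2 h0
  rw [Complex.mul_conj, Complex.normSq_eq_norm_sq]
  congr 1
  have : (-(s:ℂ)) = ((-s : ℝ) : ℂ) := by push_cast; rfl
  rw [this, Complex.norm_cpow_real, ← Real.rpow_natCast, ← Real.rpow_mul hp.le]
  congr 1; push_cast; ring

lemma dbl (s : ℝ) (hs : 0 < s) (t : ℂ) (ht : ‖t‖ < 1) :
    ∑' p : ℕ × ℕ, ((ac s p.1 : ℂ) * t ^ p.1 * ((ac s p.2 : ℂ) * (starRingEnd ℂ) t ^ p.2)) =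
      ((‖1 - t‖ ^ (-(2 * s)) : ℝ) : ℂ) := by
  have h1 := hasSum_ac s hs _ ht
  have h2 : HasSum (fun k => (ac s k : ℂ) * (starRingEnd ℂ) t ^ k) ((starRingEnd ℂ) ((1 - t) ^ (-(s:ℂ)))) := by
    have h3 := hasSum_ac s hs ((starRingEnd ℂ) t) (by rwa [RCLike.norm_conj])
    have h4 : (starRingEnd ℂ) ((1 - t) ^ (-(s:ℂ))) = (1 - (starRingEnd ℂ) t) ^ (-(s:ℂ)) := by
      have := Complex.conj_cpow (1 - t) (-(s:ℂ)) (fun h => by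
        have h0 := one_sub_re_pos ht
        have := Complex.arg_eq_pi_iff.1 h
        linarith [this.1])
      rw [map_sub, map_one] at this
      rw [this]; simp
    rw [h4]; exact h3
  have hs1 : Summable (fun k => ‖(ac s k : ℂ) * t ^ k‖) := h1.summable.norm
  have hs2 : Summable (fun k => ‖(ac s k : ℂ) * (starRingEnd ℂ) t ^ k‖) := h2.summable.norm
  rw [← ker_norm s t ht]
  rw [← h2.tsum_eq, ← h1.tsum_eq]
  exact (tsum_mul_tsum_of_summable_norm hs1 hs2).symm

lemma FR_series (d : ℕ) (hd : 0 < d) (σ : ℝ) (hσ : -1 < σ) (s : ℝ) (hs : 0 < s) (z : Cd d) (hz : ‖z‖ < 1) :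
    HasSum (fun k => fc s (d + 1 + σ) k * (‖z‖ ^ 2) ^ k)
      (cCoef d σ * ∫ w in unitBall d, (1 - ‖w‖ ^ 2) ^ σ * ‖1 - herm z w‖ ^ (-(2 * s)) ∂(normVol d)) := by
  have hrho := rho_integrable d hd σ hσ
  let F : ℕ × ℕ → Cd d → ℂ := fun p w => ((1 - ‖w‖ ^ 2) ^ σ : ℝ) •
    (((ac s p.1 : ℂ) * (ac s p.2 : ℂ)) * (herm z w ^ p.1 * (starRingEnd ℂ) (herm z w) ^ p.2))
  have hsz : Summable (fun k => ac s k * ‖z‖ ^ k) := (hasSum_ac_real s hs ‖z‖ (norm_nonneg _) hz).summable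
  have hhz : ∀ w ∈ unitBall d, ‖herm z w‖ ≤ ‖z‖ := by
    intro w hw
    have := mem_uB.1 hw
    have h2 := norm_herm_le d z w
    nlinarith [norm_nonneg z]
  have hbd : ∀ p, ∀ w ∈ unitBall d, ‖F p w‖ ≤ (1 - ‖w‖ ^ 2) ^ σ * ((ac s p.1 * ‖z‖ ^ p.1) * (ac s p.2 * ‖z‖ ^ p.2)) := by
    intro p w hw
    have h1 : 0 ≤ (1 - ‖w‖ ^ 2) := by have := mem_uB.1 hw; nlinarith [norm_nonneg w]
    have ha := (ac_pos s hs p.1).le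
    have hb := (ac_pos s hs p.2).le
    simp only [F, norm_smul, norm_mul, norm_pow, RCLike.norm_conj, Complex.norm_real,
      Real.norm_of_nonneg (Real.rpow_nonneg h1 σ), Real.norm_of_nonneg ha, Real.norm_of_nonneg hb]
    have hc := pow_le_pow_left₀ (norm_nonneg _) (hhz w hw) p.1
    have hd := pow_le_pow_left₀ (norm_nonneg _) (hhz w hw) p.2
    calc _ ≤ (1 - ‖w‖ ^ 2) ^ σ * (ac s p.1 * ac s p.2 * (‖z‖ ^ p.1 * ‖z‖ ^ p.2)) := by
          gcongr
      _ = _ := by ring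
  have hmeas : ∀ p, AEStronglyMeasurable (F p) ((normVol d).restrict (unitBall d)) := by
    intro p
    refine hrho.aestronglyMeasurable.smul ?_
    have := herm_cont d z
    have h2 : Continuous (fun w => (starRingEnd ℂ) (herm z w)) := Complex.continuous_conj.comp this
    exact (by fun_prop : Continuous _).aestronglyMeasurable
  have hFint : ∀ p, Integrable (F p) ((normVol d).restrict (unitBall d)) := by
    intro p
    refine Integrable.mono' (hrho.mul_const ((ac s p.1 * ‖z‖ ^ p.1) * (ac s p.2 * ‖z‖ ^ p.2))) (hmeas p) ?_
    filter_upwards [ae_restrict_mem (uB_meas d)] with w hw using hbd p w hw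
  have hprod : Summable (fun p : ℕ × ℕ => (ac s p.1 * ‖z‖ ^ p.1) * (ac s p.2 * ‖z‖ ^ p.2)) :=
    hsz.mul_of_nonneg hsz (fun k => mul_nonneg (ac_pos s hs k).le (by positivity))
      (fun k => mul_nonneg (ac_pos s hs k).le (by positivity))
  have hsum : Summable (fun p => ∫ w in unitBall d, ‖F p w‖ ∂(normVol d)) := by
    refine Summable.of_nonneg_of_le (fun p => integral_nonneg fun _ => norm_nonneg _) (fun p => ?_)
      (hprod.mul_left (∫ w in unitBall d, (1 - ‖w‖ ^ 2) ^ σ ∂(normVol d)))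
    rw [← integral_mul_const]
    refine setIntegral_mono_on (hFint p).norm (hrho.mul_const _) (uB_meas d) (hbd p)
  have H := hasSum_integral_of_summable_integral_norm hFint hsum
  have htsum : ∀ w ∈ unitBall d, ∑' p, F p w =
      (((1 - ‖w‖ ^ 2) ^ σ * ‖1 - herm z w‖ ^ (-(2 * s)) : ℝ) : ℂ) := by
    intro w hw
    have ht : ‖herm z w‖ < 1 := (hhz w hw).trans_lt hz
    have : (fun p => F p w) = fun p => (((1 - ‖w‖ ^ 2) ^ σ : ℝ) : ℂ) * ((ac s p.1 : ℂ) * herm z w ^ p.1 * ((ac s p.2 : ℂ) * (starRingEnd ℂ) (herm z w) ^ p.2)) := by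
      funext p
      simp only [F, Complex.real_smul]; ring
    rw [this, tsum_mul_left, dbl s hs _ ht]
    push_cast; rfl
  rw [setIntegral_congr_fun (uB_meas d) htsum, integral_complex_ofReal] at H
  have hoff : ∀ p : ℕ × ℕ, p.1 ≠ p.2 → ∫ w in unitBall d, F p w ∂(normVol d) = 0 := by
    intro p hp
    have : F p = fun w => ((ac s p.1 : ℂ) * (ac s p.2 : ℂ)) * (((1 - ‖w‖ ^ 2) ^ σ : ℝ) •
     (herm z w ^ p.1 * (starRingEnd ℂ) (herm z w) ^ p.2)) := by
      funext w
      simp only [F, Complex.real_smul]; ring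
    rw [this, integral_const_mul, offdiag d σ z _ _ hp, mul_zero]
  have hdiag : ∀ k : ℕ, (cCoef d σ : ℂ) * ∫ w in unitBall d, F (k, k) w ∂(normVol d) =
      ((fc s (d + 1 + σ) k * (‖z‖ ^ 2) ^ k : ℝ) : ℂ) := by
    intro k
    have : F (k, k) = fun w => ((ac s k ^ 2 : ℝ) : ℂ) * (((1 - ‖w‖ ^ 2) ^ σ * ‖herm z w‖ ^ (2 * k) : ℝ) : ℂ) := by
      funext w
      simp only [F, Complex.real_smul]
      rw [← mul_pow (herm z w), Complex.mul_conj, Complex.normSq_eq_norm_sq]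
      push_cast; ring
    rw [this, integral_const_mul, integral_complex_ofReal]
    have hm := moment d k hd σ hσ z
    rw [← Complex.ofReal_mul, ← Complex.ofReal_mul]
    congr 1
    rw [fc, ← pow_mul]
    linear_combination (ac s k ^ 2) * hm
  have hinj : Function.Injective (fun k : ℕ => (k, k)) := fun a b h => by simpa using h
  have H2 := (hinj.hasSum_iff (f := fun p => ∫ w in unitBall d, F p w ∂(normVol d)) (a := _) (by
    rintro ⟨a, b⟩ hp
    refine hoff _ (fun h => hp ⟨a, ?_⟩)
    simp at h; simp [h])).2 H
  have H3 := H2.mul_left (cCoef d σ : ℂ)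
  simp only [Function.comp_def, hdiag] at H3
  exact_mod_cast H3


noncomputable def JJ (d : ℕ) (φ : Cd d → ℂ) (μ : ℝ) (z : Cd d) : ℂ :=
  ∫ w in unitBall d, φ w * (1 - herm z w) ^ (-(μ:ℂ)) ∂(normVol d)

lemma herm_R {d : ℕ} {R : ℝ} {z w : Cd d} (hz : ‖z‖ ≤ R) (hw : w ∈ unitBall d) : ‖herm z w‖ ≤ R := by
  have := mem_uB.1 hw
  have h2 := norm_herm_le d z w
  nlinarith [norm_nonneg z]

lemma ker_bd {d : ℕ} {R : ℝ} {z w : Cd d} (hR : R < 1) (hz : ‖z‖ ≤ R) (hw : w ∈ unitBall d) (μ : ℝ) (hμ : 0 ≤ μ) :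
    ‖(1 - herm z w) ^ (-(μ:ℂ))‖ ≤ (1 - R) ^ (-μ) := by
  have h1 := herm_R hz hw
  have : (-(μ:ℂ)) = ((-μ : ℝ) : ℂ) := by push_cast; rfl
  rw [this, Complex.norm_cpow_real]
  refine Real.rpow_le_rpow_of_nonpos (by linarith) ?_ (by linarith)
  have := norm_sub_norm_le (1:ℂ) (herm z w)
  rw [norm_one] at this
  linarith

lemma ker_meas (d : ℕ) (z : Cd d) (c : ℂ) : Measurable (fun w : Cd d => (1 - herm z w) ^ c) :=
  (measurable_const.sub (herm_cont d z).measurable).pow_const c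

lemma ker_int {d : ℕ} {z : Cd d} (hz : ‖z‖ < 1) (μ : ℝ) (hμ : 0 ≤ μ) (φ : Cd d → ℂ)
    (hφ : IntegrableOn φ (unitBall d) (normVol d)) :
    IntegrableOn (fun w => φ w * (1 - herm z w) ^ (-(μ:ℂ))) (unitBall d) (normVol d) := by
  refine Integrable.mono' (hφ.norm.mul_const ((1 - ‖z‖) ^ (-μ)))
    (hφ.aestronglyMeasurable.mul (ker_meas d z _).aestronglyMeasurable) ?_
  filter_upwards [ae_restrict_mem (uB_meas d)] with w hw
  rw [norm_mul]
  exact mul_le_mul_of_nonneg_left (ker_bd hz le_rfl hw μ hμ) (norm_nonneg _)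

lemma conj_int {d : ℕ} (φ : Cd d → ℂ) (j : Fin d)
    (hφ : IntegrableOn φ (unitBall d) (normVol d)) :
    IntegrableOn (fun w => φ w * (starRingEnd ℂ) (w j)) (unitBall d) (normVol d) := by
  have hc : Continuous (fun w : Cd d => (starRingEnd ℂ) (w j)) := by
    refine Complex.continuous_conj.comp ?_
    fun_prop
  refine Integrable.mono' (hφ.norm) (hφ.aestronglyMeasurable.mul hc.aestronglyMeasurable) ?_
  filter_upwards [ae_restrict_mem (uB_meas d)] with w hw
  rw [norm_mul, RCLike.norm_conj]
  have h1 := PiLp.norm_apply_le w j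
  have h2 := mem_uB.1 hw
  exact mul_le_of_le_one_right (norm_nonneg _) (by linarith)

lemma ker_deriv {d : ℕ} {z w : Cd d} (hz : ‖herm z w‖ < 1) (μ : ℝ) (c : ℂ) :
    HasFDerivAt (fun z : Cd d => c * (1 - herm z w) ^ (-(μ:ℂ)))
      ((c * (μ * (1 - herm z w) ^ (-((μ + 1 : ℝ):ℂ)))) • innerSL ℂ w) z := by
  have h0 : HasFDerivAt (fun z : Cd d => 1 - herm z w) (-(innerSL ℂ w)) z := by
    have : (fun z : Cd d => 1 - herm z w) = fun z => 1 - innerSL ℂ w z := by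
      funext z; rw [herm_eq]; rfl
    rw [this]
    exact ((innerSL ℂ w).hasFDerivAt).const_sub 1
  have hs : 1 - herm z w ∈ slitPlane := Or.inl (one_sub_re_pos hz)
  have h00 : HasDerivAt (fun x : ℂ => x ^ (-(μ:ℂ))) (-(μ:ℂ) * (1 - herm z w) ^ (-(μ:ℂ) - 1)) (1 - herm z w) :=
    hasDerivAt_id (1 - herm z w) |>.cpow_const (c := -(μ:ℂ)) hs |>.congr_deriv (by simp)
  have h1 := (h00.comp_hasFDerivAt z h0).const_mul c
  refine HasFDerivAt.congr_fderiv h1 ?_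
  ext v
  simp only [smul_apply, smul_eq_mul, neg_apply]
  rw [show -((μ + 1 : ℝ):ℂ) = -(μ:ℂ) - 1 by push_cast; ring]
  ring

lemma JJ_deriv (d : ℕ) (φ : Cd d → ℂ) (hφ : IntegrableOn φ (unitBall d) (normVol d)) (μ : ℝ) (hμ : 0 < μ)
    (z : Cd d) (hz : ‖z‖ < 1) (j : Fin d) :
    pd d j (JJ d φ μ) z = μ * JJ d (fun w => φ w * (starRingEnd ℂ) (w j)) (μ + 1) z := by
  set R : ℝ := (1 + ‖z‖) / 2 with hR
  have hR1 : R < 1 := by rw [hR]; linarith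
  have hball : ∀ x ∈ ball z ((1 - ‖z‖) / 2), ‖x‖ ≤ R := by
    intro x hx
    rw [mem_ball, dist_eq_norm] at hx
    have := norm_le_norm_add_norm_sub' x z
    rw [hR]; linarith
  let F' : Cd d → Cd d → (Cd d →L[ℂ] ℂ) := fun x w =>
    (φ w * (μ * (1 - herm x w) ^ (-((μ + 1 : ℝ):ℂ)))) • innerSL ℂ w
  have hF'm : AEStronglyMeasurable (F' z) ((normVol d).restrict (unitBall d)) := by
    refine AEStronglyMeasurable.smul (𝕜 := ℂ) ?_ (innerSL ℂ (E := Cd d)).continuous.aestronglyMeasurable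
    exact hφ.aestronglyMeasurable.mul ((ker_meas d z _).const_mul _).aestronglyMeasurable
  have hbound : ∀ x, ‖x‖ ≤ R → ∀ w ∈ unitBall d, ‖F' x w‖ ≤ ‖φ w‖ * (μ * (1 - R) ^ (-(μ + 1))) := by
    intro x hx w hw
    have h1 := ker_bd hR1 hx hw (μ + 1) (by linarith)
    have h2 := mem_uB.1 hw
    simp only [F', norm_smul, norm_mul, innerSL_apply_norm, Complex.norm_real, Real.norm_of_nonneg hμ.le]
    calc _ ≤ ‖φ w‖ * (μ * (1 - R) ^ (-(μ + 1))) * 1 := by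
          gcongr
      _ = _ := mul_one _
  have key := hasFDerivAt_integral_of_dominated_of_fderiv_le (𝕜 := ℂ)
    (μ := (normVol d).restrict (unitBall d)) (F := fun x w => φ w * (1 - herm x w) ^ (-(μ:ℂ)))
    (F' := F') (x₀ := z) (s := ball z ((1 - ‖z‖) / 2))
    (bound := fun w => ‖φ w‖ * (μ * (1 - R) ^ (-(μ + 1))))
    (ball_mem_nhds _ (by linarith))
    (Eventually.of_forall fun x => hφ.aestronglyMeasurable.mul (ker_meas d x _).aestronglyMeasurable)
    (ker_int hz μ hμ.le φ hφ) hF'm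
    (by
      filter_upwards [ae_restrict_mem (uB_meas d)] with w hw
      exact fun x hx => hbound x (hball x hx) w hw)
    (hφ.norm.mul_const _)
    (by
      filter_upwards [ae_restrict_mem (uB_meas d)] with w hw
      exact fun x hx => ker_deriv ((herm_R (hball x hx) hw).trans_lt hR1) μ (φ w))
  have hF'i : Integrable (F' z) ((normVol d).restrict (unitBall d)) := by
    refine Integrable.mono' (hφ.norm.mul_const (μ * (1 - R) ^ (-(μ + 1)))) hF'm ?_
    filter_upwards [ae_restrict_mem (uB_meas d)] with w hw
    exact hbound z (by rw [hR]; linarith) w hw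
  have h3 : fderiv ℂ (JJ d φ μ) z = ∫ w in unitBall d, F' z w ∂(normVol d) := key.fderiv
  rw [pd, h3, ContinuousLinearMap.integral_apply hF'i, JJ, ← integral_const_mul]
  congr 1
  funext w
  simp only [F', smul_apply, smul_eq_mul, innerSL_apply_apply]
  rw [EuclideanSpace.inner_single_right]
  push_cast
  ring

lemma pd_congr {d : ℕ} {f g : Cd d → ℂ} (h : Set.EqOn f g (unitBall d)) (j : Fin d) :
    Set.EqOn (pd d j f) (pd d j g) (unitBall d) := by
  intro z hz
  have : f =ᶠ[𝓝 z] g := by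
    have hz' : unitBall d ∈ 𝓝 z := isOpen_ball.mem_nhds hz
    filter_upwards [hz'] with x hx using h hx
  simp only [pd]
  rw [this.fderiv_eq]

lemma pd_cJJ (d : ℕ) (φ : Cd d → ℂ) (hφ : IntegrableOn φ (unitBall d) (normVol d)) (μ : ℝ) (hμ : 0 < μ) (c : ℂ)
    (j : Fin d) (f : Cd d → ℂ) (hf : Set.EqOn f (fun z => c * JJ d φ μ z) (unitBall d)) :
    Set.EqOn (pd d j f) (fun z => (c * μ) * JJ d (fun w => φ w * (starRingEnd ℂ) (w j)) (μ + 1) z) (unitBall d) := by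
  intro z hz
  rw [pd_congr hf j hz]
  have h := JJ_deriv d φ hφ μ hμ z (mem_uB.1 hz) j
  simp only [pd] at h ⊢
  have : fderiv ℂ (fun z => c * JJ d φ μ z) z = c • fderiv ℂ (JJ d φ μ) z := by
    have := fderiv_const_smul_field (𝕜 := ℂ) (f := JJ d φ μ) c
    exact congrFun this z
  rw [this, smul_apply, h, smul_eq_mul, mul_assoc]

lemma pd_iter (d : ℕ) (φ : Cd d → ℂ) (hφ : IntegrableOn φ (unitBall d) (normVol d)) (μ : ℝ) (hμ : 0 < μ) (c : ℂ)
    (j : Fin d) (f : Cd d → ℂ) (hf : Set.EqOn f (fun z => c * JJ d φ μ z) (unitBall d)) (a : ℕ) :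
    IntegrableOn (fun w => φ w * (starRingEnd ℂ) (w j) ^ a) (unitBall d) (normVol d) ∧
    Set.EqOn ((pd d j)^[a] f) (fun z => (c * (Real.Gamma (μ + a) / Real.Gamma μ : ℝ)) *
      JJ d (fun w => φ w * (starRingEnd ℂ) (w j) ^ a) (μ + a) z) (unitBall d) := by
  have hG : Real.Gamma μ ≠ 0 := (Real.Gamma_pos_of_pos hμ).ne'
  induction a with
  | zero => simpa [div_self hG] using ⟨hφ, hf⟩
  | succ a ih =>
    have h1 := conj_int _ j ih.1
    have h2 := pd_cJJ d _ ih.1 (μ + a) (by positivity) _ j _ ih.2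
    have e : (fun w : Cd d => φ w * (starRingEnd ℂ) (w j) ^ a * (starRingEnd ℂ) (w j)) =
      fun w => φ w * (starRingEnd ℂ) (w j) ^ (a + 1) := by funext w; ring
    rw [e] at h1 h2
    refine ⟨h1, ?_⟩
    rw [Function.iterate_succ_apply']
    intro z hz
    rw [h2 hz, gam_succ_mul μ hμ]
    push_cast
    rw [add_assoc]
    ring

lemma pd_fold (d : ℕ) (φ : Cd d → ℂ) (hφ : IntegrableOn φ (unitBall d) (normVol d)) (μ : ℝ) (hμ : 0 < μ) (c : ℂ)
    (f : Cd d → ℂ) (hf : Set.EqOn f (fun z => c * JJ d φ μ z) (unitBall d)) (α : Fin d → ℕ) (L : List (Fin d)) :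
    IntegrableOn (fun w => φ w * (L.map (fun j => (starRingEnd ℂ) (w j) ^ α j)).prod) (unitBall d) (normVol d) ∧
    Set.EqOn (L.foldr (fun j g => (pd d j)^[α j] g) f)
      (fun z => (c * (Real.Gamma (μ + ((L.map α).sum : ℕ)) / Real.Gamma μ : ℝ)) *
      JJ d (fun w => φ w * (L.map (fun j => (starRingEnd ℂ) (w j) ^ α j)).prod) (μ + ((L.map α).sum : ℕ)) z)
        (unitBall d) := by
  have hG : Real.Gamma μ ≠ 0 := (Real.Gamma_pos_of_pos hμ).ne'
  induction L with
  | nil => simpa [div_self hG] using ⟨hφ, hf⟩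
  | cons j L ih =>
    have h1 := pd_iter d _ ih.1 (μ + ((L.map α).sum : ℕ)) (by positivity) _ j _ ih.2 (α j)
    have hG2 : Real.Gamma (μ + ((L.map α).sum : ℕ)) ≠ 0 := (Real.Gamma_pos_of_pos (by positivity)).ne'
    have e : (fun w : Cd d => φ w * (L.map (fun j => (starRingEnd ℂ) (w j) ^ α j)).prod * (starRingEnd ℂ) (w j) ^ (α j)) =
      fun w => φ w * ((j :: L).map (fun j => (starRingEnd ℂ) (w j) ^ α j)).prod := by
      funext w; simp only [List.map_cons, List.prod_cons]; ring
    rw [e] at h1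
    refine ⟨h1.1, ?_⟩
    intro z hz
    rw [List.foldr_cons, h1.2 hz]
    have e2 : μ + ((L.map α).sum : ℕ) + (α j : ℕ) = μ + (((j :: L).map α).sum : ℕ) := by
      simp only [List.map_cons, List.sum_cons]; push_cast; ring
    rw [e2]
    simp only []
    congr 1
    rw [mul_assoc, ← Complex.ofReal_mul]
    congr 2
    field_simp

lemma mpd_bergman (d n : ℕ) (hd : 0 < d) (σ : ℝ) (hσ : -1 < σ) (G : Cd d → ℂ) (hG : Measurable G)
    (hG1 : ∀ w, ‖G w‖ ≤ 1) (z : Cd d) (hz : ‖z‖ < 1) (α : MIdx d n) :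
    mpd d α.1 (bergman d σ G) z =
      ∫ w in unitBall d, (((cCoef d σ * (Real.Gamma (d + 1 + σ + n) / Real.Gamma (d + 1 + σ))) *
        (1 - ‖w‖ ^ 2) ^ σ : ℝ) : ℂ) * ((1 - herm z w) ^ (-((d + 1 + σ + n : ℝ) : ℂ)) * G w) *
        (starRingEnd ℂ) (Zmap d n w α) ∂(normVol d) := by
  have hl : 0 < (d:ℝ) + 1 + σ := by
    have : (0:ℝ) ≤ d := by positivity
    linarith
  have hφ : IntegrableOn (fun w => (((1 - ‖w‖ ^ 2) ^ σ : ℝ) : ℂ) * G w) (unitBall d) (normVol d) := by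
    have h := rho_integrable d hd σ hσ
    refine Integrable.mono' h.norm (h.ofReal.aestronglyMeasurable.mul hG.aestronglyMeasurable) ?_
    refine Eventually.of_forall fun w => ?_
    rw [norm_mul, Complex.norm_real]
    exact mul_le_of_le_one_right (norm_nonneg _) (hG1 w)
  have h0 : Set.EqOn (bergman d σ G) (fun z => (cCoef d σ : ℂ) * JJ d (fun w => (((1 - ‖w‖ ^ 2) ^ σ : ℝ) : ℂ) * G w)
      (d + 1 + σ) z) (unitBall d) := by
    intro z hz
    simp only [bergman, JJ, bergKer]
    congr 2
    funext w
    rw [cpow_neg]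
    ring
  have h1 := (pd_fold d _ hφ _ hl _ _ h0 α.1 (List.finRange d)).2 (mem_uB.2 hz)
  have e1 : ((List.finRange d).map α.1).sum = n := by
    rw [← List.ofFn_eq_map, List.sum_ofFn]; exact α.2
  rw [e1] at h1
  rw [mpd, h1]
  simp only [JJ]
  rw [← integral_const_mul]
  congr 1
  funext w
  have e2 : ((List.finRange d).map (fun j => (starRingEnd ℂ) (w j) ^ α.1 j)).prod = (starRingEnd ℂ) (Zmap d n w α) := by
    rw [← List.ofFn_eq_map, List.prod_ofFn, Zmap, map_prod]
    simp
  rw [e2]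
  push_cast
  ring


/-- Seminorm properties bundled. -/
structure IsN {ι : Type} (N : (ι → ℂ) → ℝ) : Prop where
  nonneg : ∀ x, 0 ≤ N x
  add : ∀ x y, N (x + y) ≤ N x + N y
  smul : ∀ (c : ℂ) (x), N (c • x) = ‖c‖ * N x

lemma IsN.zero {ι : Type} {N : (ι → ℂ) → ℝ} (h : IsN N) : N 0 = 0 := by
  have := h.smul 0 0
  simpa using this

lemma IsN.neg {ι : Type} {N : (ι → ℂ) → ℝ} (h : IsN N) (x) : N (-x) = N x := by
  have := h.smul (-1) x
  simpa using this

lemma IsN.le {ι : Type} [Fintype ι] {N : (ι → ℂ) → ℝ} (h : IsN N) :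
    ∃ C, 0 ≤ C ∧ ∀ x, N x ≤ C * ‖x‖ := by
  refine ⟨∑ i, N (Pi.single i 1), Finset.sum_nonneg fun i _ => h.nonneg _, fun x => ?_⟩
  have hs : ∀ (s : Finset ι) (f : ι → (ι → ℂ)), N (∑ i ∈ s, f i) ≤ ∑ i ∈ s, N (f i) := by
    intro s f
    induction s using Finset.induction_on with
    | empty => simp [h.zero]
    | insert a s ha ih =>
      rw [Finset.sum_insert ha, Finset.sum_insert ha]
      exact (h.add _ _).trans (by linarith)
  have e : x = ∑ i, x i • (Pi.single i 1 : ι → ℂ) := by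
    funext j
    simp [Finset.sum_apply, Pi.single_apply]
  calc N x = N (∑ i, x i • (Pi.single i 1 : ι → ℂ)) := by rw [← e]
    _ ≤ ∑ i, N (x i • (Pi.single i 1 : ι → ℂ)) := hs _ _
    _ = ∑ i, ‖x i‖ * N (Pi.single i 1) := by simp_rw [h.smul]
    _ ≤ ∑ i, ‖x‖ * N (Pi.single i 1) := Finset.sum_le_sum fun i _ =>
        mul_le_mul_of_nonneg_right (norm_le_pi_norm x i) (h.nonneg _)
    _ = _ := by rw [← Finset.mul_sum, mul_comm]

lemma IsN.cont {ι : Type} [Fintype ι] {N : (ι → ℂ) → ℝ} (h : IsN N) : Continuous N := by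
  obtain ⟨C, hC, hN⟩ := h.le
  refine (LipschitzWith.of_dist_le_mul (K := ⟨C, hC⟩) (f := N) fun x y => ?_).continuous
  rw [Real.dist_eq, dist_eq_norm, abs_le]
  have h1 := h.add (x - y) y
  have h2 := h.add (y - x) x
  rw [sub_add_cancel] at h1 h2
  have h3 := hN (x - y)
  have h4 := h.neg (x - y)
  rw [neg_sub] at h4
  change -(C * ‖x - y‖) ≤ _ ∧ _ ≤ C * ‖x - y‖
  constructor <;> linarith

lemma IsN.hb {ι : Type} [Fintype ι] {N : (ι → ℂ) → ℝ} (h : IsN N) (v : ι → ℂ) :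
    ∃ g : (ι → ℂ) →L[ℝ] ℝ, (∀ x, g x ≤ N x) ∧ g v = N v := by
  by_cases hv : v = 0
  · exact ⟨0, fun x => by simpa using h.nonneg x, by simp [hv, h.zero]⟩
  obtain ⟨g, hg1, hg2⟩ := exists_extension_of_le_sublinear (LinearPMap.mkSpanSingleton (K := ℝ) v (N v) hv) N
    (fun c hc x => by
      have := h.smul (c : ℂ) x
      rw [Complex.norm_real, Real.norm_of_nonneg hc.le] at this
      rw [← this]; congr 1)
    h.add
    (by
      rintro ⟨x, hx⟩
      obtain ⟨c, rfl⟩ := Submodule.mem_span_singleton.1 hx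
      rw [LinearPMap.mkSpanSingleton'_apply]
      have := h.smul (c : ℂ) v
      rw [Complex.norm_real] at this
      have e : (c • v) = ((c:ℂ) • v) := by ext i; simp
      change c • N v ≤ N (c • v)
      rw [e, this, smul_eq_mul]
      exact mul_le_mul_of_nonneg_right (le_abs_self c) (h.nonneg v))
  refine ⟨LinearMap.toContinuousLinearMap g, hg2, ?_⟩
  have h1 := hg1 ⟨v, Submodule.mem_span_singleton_self v⟩
  have h2 := LinearPMap.mkSpanSingleton_apply ℝ ℝ (σ := RingHom.id ℝ) hv (N v)
  change g v = N v
  exact h1.trans h2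

lemma comp_int {ι : Type} [Fintype ι] {X : Type*} [MeasurableSpace X] {m : Measure X}
    (F : X → ι → ℂ) (hF : Integrable F m) (g : (ι → ℂ) →L[ℝ] ℝ) :
    g (fun i => ∫ w, F w i ∂m) = ∫ w, g (F w) ∂m := by
  rw [g.integral_comp_comm hF]
  congr 1
  funext i
  exact ((ContinuousLinearMap.proj (R := ℝ) (φ := fun _ : ι => ℂ) i).integral_comp_comm hF)

lemma Z_cont (d n : ℕ) : Continuous (Zmap d n) := by
  unfold Zmap
  refine continuous_pi fun α => ?_
  fun_prop

lemma Z_smul (d n : ℕ) (c : ℂ) (w : Cd d) : Zmap d n (c • w) = c ^ n • Zmap d n w := by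
  funext α
  have h : ∑ j, α.1 j = n := α.2
  have h2 : ∏ j, c ^ α.1 j = c ^ n := by rw [Finset.prod_pow_eq_pow_sum, h]
  simp only [Zmap, Pi.smul_apply, smul_eq_mul, PiLp.smul_apply, mul_pow]
  rw [Finset.prod_mul_distrib, h2]

lemma maxC_bdd (d n : ℕ) (N : (MIdx d n → ℂ) → ℝ) (h : IsN N) :
    BddAbove (Set.range fun ζ : Metric.sphere (0 : Cd d) 1 => N (Zmap d n (ζ : Cd d))) := by
  have hc : Continuous fun ζ : Metric.sphere (0 : Cd d) 1 => N (Zmap d n (ζ : Cd d)) :=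
    h.cont.comp ((Z_cont d n).comp continuous_subtype_val)
  exact (isCompact_range hc).bddAbove

lemma maxC_nonneg (d n : ℕ) (N : (MIdx d n → ℂ) → ℝ) (h : IsN N) : 0 ≤ maxC d n N :=
  Real.iSup_nonneg fun _ => h.nonneg _

lemma NZ_le (d n : ℕ) (hn : 0 < n) (N : (MIdx d n → ℂ) → ℝ) (h : IsN N) (w : Cd d) (hw : ‖w‖ < 1) :
    N (Zmap d n w) ≤ maxC d n N := by
  by_cases h0 : w = 0
  · have : Zmap d n w = 0 := by
      have := Z_smul d n 0 w
      rw [h0] at this ⊢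
      simpa [hn.ne'] using this
    rw [this, h.zero]
    exact maxC_nonneg d n N h
  have hw0 : ‖w‖ ≠ 0 := norm_ne_zero_iff.2 h0
  let ζ : Cd d := ((‖w‖ : ℂ)⁻¹) • w
  have hζ : ‖ζ‖ = 1 := by simp [ζ, norm_smul, hw0]
  have e : w = (‖w‖ : ℂ) • ζ := by
    simp only [ζ]; rw [smul_smul, mul_inv_cancel₀ (by exact_mod_cast hw0), one_smul]
  rw [e, Z_smul, h.smul, norm_pow, Complex.norm_real, norm_norm]
  have h1 : N (Zmap d n ζ) ≤ maxC d n N :=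
    le_ciSup (maxC_bdd d n N h) ⟨ζ, by simpa using hζ⟩
  have h2 : ‖w‖ ^ n ≤ 1 := pow_le_one₀ (norm_nonneg _) hw.le
  have h3 := h.nonneg (Zmap d n ζ)
  nlinarith


lemma cCoef_pos (d : ℕ) (σ : ℝ) (hσ : -1 < σ) : 0 < cCoef d σ := by
  have hd : (0:ℝ) ≤ d := by positivity
  have h1 : 0 < Real.Gamma (σ + 1) := Real.Gamma_pos_of_pos (by linarith)
  have h2 : 0 < Real.Gamma ((d:ℝ) + 1) := Real.Gamma_pos_of_pos (by linarith)
  have h3 : 0 < Real.Gamma ((d:ℝ) + σ + 1) := Real.Gamma_pos_of_pos (by linarith)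
  unfold cCoef; positivity

lemma rho_nonneg {d : ℕ} {w : Cd d} (hw : w ∈ unitBall d) (σ : ℝ) : 0 ≤ (1 - ‖w‖ ^ 2) ^ σ := by
  have := mem_uB.1 hw
  exact Real.rpow_nonneg (by nlinarith [norm_nonneg w]) σ

lemma rk_int (d : ℕ) (hd : 0 < d) (σ : ℝ) (hσ : -1 < σ) (s : ℝ) (hs : 0 < s) (z : Cd d) (hz : ‖z‖ < 1) :
    IntegrableOn (fun w => (1 - ‖w‖ ^ 2) ^ σ * ‖1 - herm z w‖ ^ (-(2 * s))) (unitBall d) (normVol d) := by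
  have h := ker_int hz (2 * s) (by positivity) _ (rho_integrable d hd σ hσ).ofReal
  refine h.norm.congr ?_
  filter_upwards [ae_restrict_mem (uB_meas d)] with w hw
  have : (-((2 * s : ℝ):ℂ)) = ((-(2 * s) : ℝ) : ℂ) := by push_cast; rfl
  rw [norm_mul, this, Complex.norm_cpow_real]
  change ‖(((1 - ‖w‖ ^ 2) ^ σ : ℝ) : ℂ)‖ * _ = _
  rw [Complex.norm_real, Real.norm_of_nonneg (rho_nonneg hw σ)]

/-- The vector integrand. -/
noncomputable def PH (d n : ℕ) (σ : ℝ) (G : Cd d → ℂ) (z w : Cd d) : MIdx d n → ℂ :=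
  ((((cCoef d σ * (Real.Gamma (d + 1 + σ + n) / Real.Gamma (d + 1 + σ))) *
        (1 - ‖w‖ ^ 2) ^ σ : ℝ) : ℂ) * ((1 - herm z w) ^ (-((d + 1 + σ + n : ℝ) : ℂ)) * G w)) •
        (fun α => (starRingEnd ℂ) (Zmap d n w α))

lemma conjZ_cont (d n : ℕ) : Continuous (fun w : Cd d => fun α => (starRingEnd ℂ) (Zmap d n w α)) :=
  continuous_pi fun α => Complex.continuous_conj.comp ((continuous_apply α).comp (Z_cont d n))

lemma PH_norm (d n : ℕ) (hd : 0 < d) (σ : ℝ) (hσ : -1 < σ) (G : Cd d → ℂ)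
    (hG1 : ∀ w, ‖G w‖ ≤ 1) (z w : Cd d) (hw : w ∈ unitBall d) :
    ‖((((cCoef d σ * (Real.Gamma (d + 1 + σ + n) / Real.Gamma (d + 1 + σ))) *
        (1 - ‖w‖ ^ 2) ^ σ : ℝ) : ℂ) * ((1 - herm z w) ^ (-((d + 1 + σ + n : ℝ) : ℂ)) * G w))‖ ≤
     (cCoef d σ * (Real.Gamma (d + 1 + σ + n) / Real.Gamma (d + 1 + σ))) *
        ((1 - ‖w‖ ^ 2) ^ σ * ‖1 - herm z w‖ ^ (-(2 * ((d + 1 + σ + n) / 2)))) := by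
  have hl : 0 < (d:ℝ) + 1 + σ := by
    have : (0:ℝ) ≤ d := by positivity
    linarith
  have h1 : 0 < Real.Gamma ((d:ℝ) + 1 + σ) := Real.Gamma_pos_of_pos hl
  have h2 : 0 < Real.Gamma ((d:ℝ) + 1 + σ + n) := Real.Gamma_pos_of_pos (by positivity)
  have h3 := cCoef_pos d σ hσ
  have h4 := rho_nonneg hw σ
  have : (-((d + 1 + σ + n : ℝ):ℂ)) = ((-(d + 1 + σ + n) : ℝ) : ℂ) := by push_cast; rfl
  rw [norm_mul, norm_mul, Complex.norm_real, Real.norm_of_nonneg (by positivity), this, Complex.norm_cpow_real,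
    mul_div_cancel₀ _ (two_ne_zero), ← mul_assoc, ← mul_assoc]
  exact mul_le_of_le_one_right (by positivity) (hG1 w)

lemma PH_int (d n : ℕ) (hd : 0 < d) (σ : ℝ) (hσ : -1 < σ) (G : Cd d → ℂ) (hG : Measurable G)
    (hG1 : ∀ w, ‖G w‖ ≤ 1) (z : Cd d) (hz : ‖z‖ < 1) :
    Integrable (PH d n σ G z) ((normVol d).restrict (unitBall d)) := by
  have hl : 0 < (d:ℝ) + 1 + σ := by
    have : (0:ℝ) ≤ d := by positivity
    linarith
  have hi := rk_int d hd σ hσ ((d + 1 + σ + n) / 2) (by positivity) z hz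
  refine Integrable.mono' (hi.const_mul (cCoef d σ * (Real.Gamma (d + 1 + σ + n) / Real.Gamma (d + 1 + σ)))) ?_ ?_
  · refine AEStronglyMeasurable.smul (𝕜 := ℂ) ?_ (conjZ_cont d n).aestronglyMeasurable
    refine AEStronglyMeasurable.mul ?_ ((ker_meas d z _).mul hG).aestronglyMeasurable
    exact ((rho_integrable d hd σ hσ).const_mul _).ofReal.aestronglyMeasurable
  · filter_upwards [ae_restrict_mem (uB_meas d)] with w hw
    have h1 := PH_norm d n hd σ hσ G hG1 z w hw
    rw [PH, norm_smul]
    refine (mul_le_of_le_one_right (norm_nonneg _) ?_).trans h1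
    rw [pi_norm_le_iff_of_nonneg zero_le_one]
    intro α
    rw [RCLike.norm_conj, Zmap, norm_prod]
    refine Finset.prod_le_one (fun _ _ => norm_nonneg _) (fun j _ => ?_)
    rw [norm_pow]
    exact pow_le_one₀ (norm_nonneg _) ((PiLp.norm_apply_le w j).trans (mem_uB.1 hw).le)

lemma Dmap_eq (d n : ℕ) (hd : 0 < d) (σ : ℝ) (hσ : -1 < σ) (G : Cd d → ℂ) (hG : Measurable G)
    (hG1 : ∀ w, ‖G w‖ ≤ 1) (z : Cd d) (hz : ‖z‖ < 1) :
    Dmap d n (bergman d σ G) z = fun α => ∫ w in unitBall d, PH d n σ G z w α ∂(normVol d) := by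
  funext α
  rw [Dmap, mpd_bergman d n hd σ hσ G hG hG1 z hz α]
  rfl

lemma const_eq (d n : ℕ) (hn : 0 < n) (σ : ℝ) (hσ : -1 < σ) :
    (Real.Gamma (d + 1 + σ + n) / Real.Gamma (d + 1 + σ)) * MM ((d + 1 + σ + n) / 2) (d + 1 + σ) n =
    Real.Gamma (d + 1 + σ + n) * Real.Gamma n / Real.Gamma ((d + 1 + σ + n) / 2) ^ 2 := by
  have hl : 0 < (d:ℝ) + 1 + σ := by
    have : (0:ℝ) ≤ d := by positivity
    linarith
  have h1 : 0 < Real.Gamma ((d:ℝ) + 1 + σ) := Real.Gamma_pos_of_pos hl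
  unfold MM
  field_simp

lemma upper (d n : ℕ) (hd : 0 < d) (hn : 0 < n) (σ : ℝ) (hσ : -1 < σ) (N : (MIdx d n → ℂ) → ℝ) (hN : IsN N)
    (hN_conj : ∀ x, N (fun i => (starRingEnd ℂ) (x i)) = N x)
    (G : Cd d → ℂ) (hG : Measurable G)
    (hG1 : ∀ w, ‖G w‖ ≤ 1) (z : Cd d) (hz : ‖z‖ < 1) :
    (1 - ‖z‖ ^ 2) ^ n * N (Dmap d n (bergman d σ G) z) ≤
      maxC d n N * (Real.Gamma (d + 1 + σ + n) * Real.Gamma n / Real.Gamma ((d + 1 + σ + n) / 2) ^ 2) := by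
  have hl : 0 < (d:ℝ) + 1 + σ := by
    have : (0:ℝ) ≤ d := by positivity
    linarith
  have hn' : (0:ℝ) < n := by exact_mod_cast hn
  set q := Real.Gamma (d + 1 + σ + n) / Real.Gamma (d + 1 + σ) with hq
  have hq0 : 0 < q := div_pos (Real.Gamma_pos_of_pos (by positivity)) (Real.Gamma_pos_of_pos hl)
  have hM0 := maxC_nonneg d n N hN
  have hi := rk_int d hd σ hσ ((d + 1 + σ + n) / 2) (by positivity) z hz
  have hF := PH_int d n hd σ hσ G hG hG1 z hz
  have hFR := FR_series d hd σ hσ ((d + 1 + σ + n) / 2) (by positivity) z hz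
  have hup := fr_upper _ _ n hl hn' (by ring) (‖z‖ ^ 2) _ (by positivity) (by nlinarith [norm_nonneg z]) hFR
  rw [Real.rpow_natCast] at hup
  obtain ⟨g, hg1, hg2⟩ := hN.hb (Dmap d n (bergman d σ G) z)
  rw [← const_eq d n hn σ hσ, ← hq, ← hg2, Dmap_eq d n hd σ hσ G hG hG1 z hz, comp_int _ hF g]
  have h1 : ∫ w in unitBall d, g (PH d n σ G z w) ∂(normVol d) ≤
      ∫ w in unitBall d, (maxC d n N * (cCoef d σ * q)) * ((1 - ‖w‖ ^ 2) ^ σ *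
        ‖1 - herm z w‖ ^ (-(2 * ((d + 1 + σ + n) / 2)))) ∂(normVol d) := by
    refine setIntegral_mono_on (g.integrable_comp hF) (hi.const_mul _) (uB_meas d) (fun w hw => ?_)
    refine (hg1 _).trans ?_
    rw [PH, hN.smul, hN_conj]
    have h2 := PH_norm d n hd σ hσ G hG1 z w hw
    have h3 := NZ_le d n hn N hN w (mem_uB.1 hw)
    rw [← hq] at h2 ⊢
    exact (mul_le_mul h2 h3 (hN.nonneg _) ((norm_nonneg _).trans h2)).trans (le_of_eq (by ring))
  rw [integral_const_mul] at h1
  have h5 : 0 ≤ (1 - ‖z‖ ^ 2) ^ n := pow_nonneg (by nlinarith [norm_nonneg z]) n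
  refine (mul_le_mul_of_nonneg_left h1 h5).trans ?_
  have := mul_le_mul_of_nonneg_left hup (mul_nonneg hM0 hq0.le)
  linarith

/-- Phase function. -/
noncomputable def phase (d : ℕ) (μ : ℝ) (z w : Cd d) : ℂ :=
  (starRingEnd ℂ) ((1 - herm z w) ^ (-(μ:ℂ))) * ((‖(1 - herm z w) ^ (-(μ:ℂ))‖⁻¹ : ℝ) : ℂ)

lemma phase_meas (d : ℕ) (μ : ℝ) (z : Cd d) : Measurable (phase d μ z) := by
  have h := ker_meas d z (-(μ:ℂ))
  have h1 : Measurable (fun w : Cd d => (starRingEnd ℂ) ((1 - herm z w) ^ (-(μ:ℂ)))) :=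
    Complex.continuous_conj.measurable.comp h
  have h2 : Measurable (fun w : Cd d => ((‖(1 - herm z w) ^ (-(μ:ℂ))‖⁻¹ : ℝ) : ℂ)) :=
    Complex.measurable_ofReal.comp h.norm.inv
  exact h1.mul h2

lemma phase_le (d : ℕ) (μ : ℝ) (z w : Cd d) : ‖phase d μ z w‖ ≤ 1 := by
  rw [phase, norm_mul, RCLike.norm_conj, Complex.norm_real, norm_inv, norm_norm]
  exact mul_inv_le_one

lemma phase_mul (d : ℕ) (μ : ℝ) (z w : Cd d) :
    (1 - herm z w) ^ (-(μ:ℂ)) * phase d μ z w = ((‖1 - herm z w‖ ^ (-μ) : ℝ) : ℂ) := by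
  have : (-(μ:ℂ)) = ((-μ : ℝ) : ℂ) := by push_cast; rfl
  rw [← Complex.norm_cpow_real, ← this, phase, ← mul_assoc, Complex.mul_conj, Complex.normSq_eq_norm_sq,
    ← Complex.ofReal_mul]
  congr 1
  by_cases h : ‖(1 - herm z w) ^ (-(μ:ℂ))‖ = 0
  · simp [h]
  · field_simp

lemma far_bound (d : ℕ) (ζ w : Cd d) (hζ : ‖ζ‖ = 1) (hw : ‖w‖ < 1) (r δ : ℝ) (hr : 1 / 2 ≤ r) (hr1 : r < 1)
    (hδ : 0 < δ) (h : δ ≤ ‖w - ζ‖) : δ ^ 2 / 4 ≤ ‖1 - herm ((r:ℂ) • ζ) w‖ := by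
  have h1 : ‖w - ζ‖ ^ 2 = ‖w‖ ^ 2 - 2 * (inner ℂ w ζ).re + ‖ζ‖ ^ 2 := norm_sub_sq (𝕜 := ℂ) w ζ
  have h2 : (1 - herm ((r:ℂ) • ζ) w).re = 1 - r * (inner ℂ w ζ).re := by
    rw [herm_eq, inner_smul_right]; simp
  have h3 := Complex.re_le_norm (1 - herm ((r:ℂ) • ζ) w)
  rw [h2] at h3
  refine le_trans ?_ h3
  rw [hζ] at h1
  have h4 : δ ^ 2 ≤ ‖w - ζ‖ ^ 2 := by gcongr
  have h5 : ‖w‖ ^ 2 ≤ 1 := by nlinarith [norm_nonneg w]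
  have h6 : (inner ℂ w ζ).re ≤ 1 - δ ^ 2 / 2 := by nlinarith
  nlinarith [sq_nonneg δ]


lemma lower (d n : ℕ) (hd : 0 < d) (hn : 0 < n) (σ : ℝ) (hσ : -1 < σ) (N : (MIdx d n → ℂ) → ℝ) (hN : IsN N)
    (hN_conj : ∀ x, N (fun i => (starRingEnd ℂ) (x i)) = N x) (L : ℝ)
    (hL : ∀ (G : Cd d → ℂ), Measurable G → (∀ w, ‖G w‖ ≤ 1) → ∀ z : Cd d, ‖z‖ < 1 →
      (1 - ‖z‖ ^ 2) ^ n * N (Dmap d n (bergman d σ G) z) ≤ L)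
    (ζ : Cd d) (hζ : ‖ζ‖ = 1) (ε : ℝ) (hε : 0 < ε) :
    (N (Zmap d n ζ) - ε) * (Real.Gamma (d + 1 + σ + n) * Real.Gamma n / Real.Gamma ((d + 1 + σ + n) / 2) ^ 2)
      ≤ L := by
  have hl : 0 < (d:ℝ) + 1 + σ := by
    have : (0:ℝ) ≤ d := by positivity
    linarith
  have hn' : (0:ℝ) < n := by exact_mod_cast hn
  rw [← const_eq d n hn σ hσ]
  set q := Real.Gamma (d + 1 + σ + n) / Real.Gamma (d + 1 + σ) with hq
  have hq0 : 0 < q := div_pos (Real.Gamma_pos_of_pos (by positivity)) (Real.Gamma_pos_of_pos hl)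
  set s : ℝ := (d + 1 + σ + n) / 2 with hs
  have hs0 : 0 < s := by positivity
  have h2s : (d:ℝ) + 1 + σ + n = 2 * s := by rw [hs]; ring
  have hc0 := cCoef_pos d σ hσ
  set c := cCoef d σ with hc
  have hM0 := maxC_nonneg d n N hN
  set M := maxC d n N with hM
  set A := N (Zmap d n ζ) with hA
  have hAM : A ≤ M := le_ciSup (maxC_bdd d n N hN) ⟨ζ, by simpa using hζ⟩
  have hrho := rho_integrable d hd σ hσ
  let Zc : Cd d → MIdx d n → ℂ := fun w => fun α => (starRingEnd ℂ) (Zmap d n w α)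
  have hZc : ∀ w, N (Zc w) = N (Zmap d n w) := fun w => hN_conj _
  obtain ⟨g, hg1, hg2⟩ := hN.hb (Zc ζ)
  have hHc : Continuous (fun w => g (Zc w)) := g.continuous.comp (conjZ_cont d n)
  obtain ⟨δ, hδ, hnear⟩ := Metric.continuousAt_iff.1 (hHc.continuousAt (x := ζ)) ε hε
  have hlow : ∀ w ∈ unitBall d, -M ≤ g (Zc w) := by
    intro w hw
    have h1 := hg1 (-Zc w)
    rw [map_neg, hN.neg, hZc] at h1
    have h2 := NZ_le d n hn N hN w (mem_uB.1 hw)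
    linarith
  set κ : ℝ := (δ ^ 2 / 4) ^ (-(2 * s)) with hκ
  have hκ0 : 0 ≤ κ := Real.rpow_nonneg (by positivity) _
  set B : ℝ := ∫ w in unitBall d, (2 * M * (c * q) * κ) * (1 - ‖w‖ ^ 2) ^ σ ∂(normVol d) with hB
  let S : ℝ → ℝ := fun x => c * ∫ w in unitBall d, (1 - ‖w‖ ^ 2) ^ σ *
    ‖1 - herm (((Real.sqrt x : ℝ) : ℂ) • ζ) w‖ ^ (-(2 * s)) ∂(normVol d)
  have hnz : ∀ x : ℝ, ‖((Real.sqrt x : ℝ) : ℂ) • ζ‖ = Real.sqrt x := by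
    intro x
    rw [norm_smul, hζ, Complex.norm_real, mul_one, Real.norm_of_nonneg (Real.sqrt_nonneg x)]
  have hS : ∀ x, 0 ≤ x → x < 1 → HasSum (fun k => fc s (d + 1 + σ) k * x ^ k) (S x) := by
    intro x hx hx1
    have := FR_series d hd σ hσ s hs0 (((Real.sqrt x : ℝ) : ℂ) • ζ) (by
      rw [hnz, Real.sqrt_lt' one_pos]; simpa using hx1)
    rw [hnz, Real.sq_sqrt hx] at this
    exact this
  have hT := fr_lower s (d + 1 + σ) n hl hn' (by rw [← h2s]) S hS
  have key : ∀ x : ℝ, 1 / 4 ≤ x → x < 1 →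
      (A - ε) * q * ((1 - x) ^ (n:ℝ) * S x) - (1 - x) ^ (n:ℝ) * B ≤ L := by
    intro x hx hx1
    set z : Cd d := ((Real.sqrt x : ℝ) : ℂ) • ζ with hz
    have hx0 : 0 ≤ x := by linarith
    have hsq1 : Real.sqrt x < 1 := by rw [Real.sqrt_lt' one_pos]; simpa using hx1
    have hsq2 : 1 / 2 ≤ Real.sqrt x := Real.le_sqrt_of_sq_le (by norm_num; linarith)
    have hz1 : ‖z‖ < 1 := by rw [hnz]; exact hsq1
    have hzz : ‖z‖ ^ 2 = x := by rw [hnz, Real.sq_sqrt hx0]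
    have h1 := hL (phase d (d + 1 + σ + n) z) (phase_meas d _ z) (phase_le d _ z) z hz1
    have hF := PH_int d n hd σ hσ (phase d (d + 1 + σ + n) z) (phase_meas d _ z) (phase_le d _ z) z hz1
    have h2 := hg1 (Dmap d n (bergman d σ (phase d (d + 1 + σ + n) z)) z)
    rw [Dmap_eq d n hd σ hσ _ (phase_meas d _ z) (phase_le d _ z) z hz1, comp_int _ hF g] at h2
    rw [Dmap_eq d n hd σ hσ _ (phase_meas d _ z) (phase_le d _ z) z hz1] at h1
    have hi := rk_int d hd σ hσ s hs0 z hz1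
    have h3 : ∫ w in unitBall d, (((A - ε) * (c * q)) * ((1 - ‖w‖ ^ 2) ^ σ * ‖1 - herm z w‖ ^ (-(2 * s))) -
        (2 * M * (c * q) * κ) * (1 - ‖w‖ ^ 2) ^ σ) ∂(normVol d) ≤
        ∫ w in unitBall d, g (PH d n σ (phase d (d + 1 + σ + n) z) z w) ∂(normVol d) := by
      refine setIntegral_mono_on ((hi.const_mul _).sub (hrho.const_mul _)) (g.integrable_comp hF) (uB_meas d)
        (fun w hw => ?_)
      have hρ := rho_nonneg hw σ
      set ρ := (1 - ‖w‖ ^ 2) ^ σ with hρd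
      have hk0 : 0 ≤ ‖1 - herm z w‖ ^ (-(2 * s)) := Real.rpow_nonneg (norm_nonneg _) _
      have e1 : g (PH d n σ (phase d (d + 1 + σ + n) z) z w) =
          (c * q * ρ * ‖1 - herm z w‖ ^ (-(2 * s))) * g (Zc w) := by
        rw [PH, phase_mul, ← Complex.ofReal_mul, ← hq, h2s, ← smul_eq_mul (a := c * q * ρ * _), ← g.map_smul]
        congr 1
      rw [e1]
      set k := ‖1 - herm z w‖ ^ (-(2 * s)) with hk
      have ha : 0 ≤ c * q * ρ := by positivity
      by_cases hwd : dist w ζ < δ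
      · have h5 := hnear hwd
        rw [Real.dist_eq, abs_lt] at h5
        have h6 : g (Zc ζ) = A := by rw [hg2, hZc]
        have h7 : A - ε ≤ g (Zc w) := by linarith [h5.1]
        have h8 := mul_le_mul_of_nonneg_left h7 (mul_nonneg ha hk0)
        have h9 : 0 ≤ 2 * M * (c * q) * κ * ρ := by positivity
        linarith
      · have h5 : δ ≤ ‖w - ζ‖ := by rw [← dist_eq_norm]; exact not_lt.1 hwd
        have h6 := far_bound d ζ w hζ (mem_uB.1 hw) _ δ hsq2 hsq1 hδ h5
        have h7 : k ≤ κ := Real.rpow_le_rpow_of_nonpos (by positivity) h6 (by linarith)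
        have h8 : A - ε - 2 * M ≤ g (Zc w) := by linarith [hlow w hw]
        have h9 := mul_le_mul_of_nonneg_left h8 (mul_nonneg ha hk0)
        have h10 := mul_le_mul_of_nonneg_left h7 (mul_nonneg (mul_nonneg zero_le_two hM0) ha)
        linarith
    rw [integral_sub (hi.const_mul _) (hrho.const_mul _), integral_const_mul, ← hB] at h3
    have h4 : 0 ≤ (1 - x) ^ n := pow_nonneg (by linarith) n
    rw [hzz] at h1
    have h5 := mul_le_mul_of_nonneg_left (h3.trans h2) h4
    rw [Real.rpow_natCast]
    have h6 : S x = c * ∫ w in unitBall d, (1 - ‖w‖ ^ 2) ^ σ * ‖1 - herm z w‖ ^ (-(2 * s)) ∂(normVol d) := rfl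
    rw [h6]
    refine le_trans (le_of_eq ?_) (h5.trans h1)
    ring
  have hT2 : Tendsto (fun x : ℝ => (1 - x) ^ (n:ℝ)) (𝓝[<] 1) (𝓝 0) := by
    have : Continuous (fun x : ℝ => (1 - x) ^ n) := by fun_prop
    have h := (this.tendsto 1).mono_left (nhdsWithin_le_nhds (s := Set.Iio 1))
    simpa [hn.ne'] using h
  have hT3 := (hT.const_mul ((A - ε) * q)).sub (hT2.mul_const B)
  rw [zero_mul, sub_zero, mul_assoc] at hT3
  refine le_of_tendsto hT3 ?_
  filter_upwards [Ico_mem_nhdsLT (show (1/4:ℝ) < 1 by norm_num)] with x hx using key x hx.1 hx.2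


end

/-- The seminorm of the Bergman projection `T_σ : L^∞(B) → 𝓑` equals
`𝓒 · Γ(λ+n)Γ(n)/Γ((λ+n)/2)²`, for any conjugation-invariant norm `N` on `ℂ^{d̃}`. -/
theorem bergman_projection_seminorm
    (d n : ℕ) (hd : 0 < d) (hn : 0 < n) (σ : ℝ) (hσ : -1 < σ)
    (lam : ℝ) (hlam : lam = d + 1 + σ)
    (N : (MIdx d n → ℂ) → ℝ)
    (hN_nonneg : ∀ x, 0 ≤ N x)
    (hN_def : ∀ x, N x = 0 → x = 0)
    (hN_add : ∀ x y, N (x + y) ≤ N x + N y)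
    (hN_smul : ∀ (c : ℂ) (x), N (c • x) = ‖c‖ * N x)
    (hN_conj : ∀ x, N (fun i => (starRingEnd ℂ) (x i)) = N x) :
    opSemi d n σ N =
      maxC d n N * (Real.Gamma (lam + n) * Real.Gamma n / Real.Gamma ((lam + n) / 2) ^ 2) := by
  subst hlam
  have hN : IsN N := ⟨hN_nonneg, hN_add, hN_smul⟩
  have hup := upper d n hd hn σ hσ N hN hN_conj
  set K := Real.Gamma (d + 1 + σ + n) * Real.Gamma n / Real.Gamma ((d + 1 + σ + n) / 2) ^ 2 with hK
  have hK0 : 0 < K := by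
    have hl : 0 < (d:ℝ) + 1 + σ := by
      have : (0:ℝ) ≤ d := by positivity
      linarith
    have hn' : (0:ℝ) < n := by exact_mod_cast hn
    have h1 : 0 < Real.Gamma ((d:ℝ) + 1 + σ + n) := Real.Gamma_pos_of_pos (by positivity)
    have h2 : 0 < Real.Gamma (n:ℝ) := Real.Gamma_pos_of_pos hn'
    have h3 : 0 < Real.Gamma (((d:ℝ) + 1 + σ + n) / 2) := Real.Gamma_pos_of_pos (by positivity)
    positivity
  have hb1 : ∀ G : {G : Cd d → ℂ // Measurable G ∧ ∀ w, ‖G w‖ ≤ 1}, BddAbove (Set.range fun z : unitBall d =>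
      (1 - ‖(z : Cd d)‖ ^ 2) ^ n * N (Dmap d n (bergman d σ G.1) z)) := by
    intro G
    refine ⟨maxC d n N * K, ?_⟩
    rintro _ ⟨z, rfl⟩
    exact hup G.1 G.2.1 G.2.2 z (mem_uB.1 z.2)
  have hne : Nonempty (unitBall d) := ⟨⟨0, mem_uB.2 (by simp)⟩⟩
  have hle : ∀ G : {G : Cd d → ℂ // Measurable G ∧ ∀ w, ‖G w‖ ≤ 1},
      blochSemi d n N (bergman d σ G.1) ≤ maxC d n N * K := fun G =>
    ciSup_le fun z => hup G.1 G.2.1 G.2.2 z (mem_uB.1 z.2)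
  have hb2 : BddAbove (Set.range fun G : {G : Cd d → ℂ // Measurable G ∧ ∀ w, ‖G w‖ ≤ 1} =>
      blochSemi d n N (bergman d σ G.1)) := by
    refine ⟨maxC d n N * K, ?_⟩
    rintro _ ⟨G, rfl⟩
    exact hle G
  have hneG : Nonempty {G : Cd d → ℂ // Measurable G ∧ ∀ w, ‖G w‖ ≤ 1} :=
    ⟨⟨fun _ => 0, measurable_const, fun w => by simp⟩⟩
  refine le_antisymm (ciSup_le hle) ?_
  have hL : ∀ (G : Cd d → ℂ), Measurable G → (∀ w, ‖G w‖ ≤ 1) → ∀ z : Cd d, ‖z‖ < 1 →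
      (1 - ‖z‖ ^ 2) ^ n * N (Dmap d n (bergman d σ G) z) ≤ opSemi d n σ N := by
    intro G hG hG1 z hz
    have h1 := le_ciSup (hb1 ⟨G, hG, hG1⟩) ⟨z, mem_uB.2 hz⟩
    have h2 := le_ciSup hb2 ⟨G, hG, hG1⟩
    exact h1.trans h2
  rw [← le_div_iff₀ hK0]
  have hneS : Nonempty (Metric.sphere (0 : Cd d) 1) :=
    ⟨⟨EuclideanSpace.single ⟨0, hd⟩ 1, by simp⟩⟩
  refine ciSup_le fun ζ => ?_
  refine le_of_forall_pos_le_add fun ε hε => ?_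
  have h := lower d n hd hn σ hσ N hN hN_conj _ hL ζ (by simpa using ζ.2) ε hε
  rw [← hK, ← le_div_iff₀ hK0] at h
  linarith
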